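/- arXiv:2308.03066 — 2 statements merged into one kernel-verified Lean document; each statement's English description precedes it below -/
import Mathlib

section
/- Let G be a finite group and let Γ = SC(G, T₁₁, T₂₂, T₁₂, T₂₁) be a quasi-abelian semi-Cayley digraph with adjacency matrix A (a matrix over ℚ with 0/1 entries), and I₁, I₂, I₃ as below. Then the splitting field SF(Γ) — the subfield of ℂ generated over ℚ by all complex roots of the characteristic polynomial of A — equals the subfield of ℂ generated over ℚ by the set {χ(I₁) : χ an irreducible complex character of G} together with all z ∈ ℂ such that z² = d_χ·(χ(I₂ \ I₃) − χ(I₃ \ I₂)) for some irreducible complex character χ of G. -/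
open IntermediateField

/-- A finset of elements of a group is conjugation-closed if its image under
conjugation by any group element equals itself. -/
def ConjClosedF {G : Type*} [Group G] [DecidableEq G] (T : Finset G) : Prop :=
  ∀ g : G, T.image (fun x => g⁻¹ * x * g) = T

/-- The adjacency matrix (over ℚ, with 0/1 entries) of the semi-Cayley digraph
`SC(G, T₁₁, T₂₂, T₁₂, T₂₁)`, with the two copies of `G` given by the two summands of
`G ⊕ G`. -/
def scMatrix {G : Type*} [Group G] [DecidableEq G] (T11 T22 T12 T21 : Finset G) :
    Matrix (G ⊕ G) (G ⊕ G) ℚ :=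
  fun x y =>
    match x, y with
    | Sum.inl h, Sum.inl g => if g * h⁻¹ ∈ T11 then 1 else 0
    | Sum.inr h, Sum.inr g => if g * h⁻¹ ∈ T22 then 1 else 0
    | Sum.inl h, Sum.inr g => if g * h⁻¹ ∈ T12 then 1 else 0
    | Sum.inr h, Sum.inl g => if g * h⁻¹ ∈ T21 then 1 else 0

/-- The multiset of pairwise products `[x·y : x ∈ X, y ∈ Y]` of two multisets of a group. -/
def msProd {G : Type*} [Group G] (X Y : Multiset G) : Multiset G :=
  X.bind (fun x => Y.map (fun y => x * y))

/-- `χ : G → ℂ` is an irreducible complex character of `G` if it is the trace function of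
a nonzero irreducible finite-dimensional complex representation of `G`. -/
def IsIrrChar (G : Type*) [Group G] (χ : G → ℂ) : Prop :=
  ∃ (V : Type) (_ : AddCommGroup V) (_ : Module ℂ V) (_ : FiniteDimensional ℂ V)
    (_ : Nontrivial V) (ρ : Representation ℂ G V),
    (∀ W : Submodule ℂ V, (∀ g : G, ∀ v ∈ W, ρ g v ∈ W) → W = ⊥ ∨ W = ⊤) ∧
    ∀ g : G, χ g = LinearMap.trace ℂ V (ρ g)

theorem ConjClosedF.conj_mem_iff {G : Type*} [Group G] [DecidableEq G] {T : Finset G}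
    (hT : ConjClosedF T) (g x : G) : g⁻¹ * x * g ∈ T ↔ x ∈ T := by
  have key : ∀ (g : G) {x : G}, x ∈ T → g⁻¹ * x * g ∈ T := fun g x hx => by
    have h := Finset.mem_image_of_mem (fun x => g⁻¹ * x * g) hx
    rwa [hT g] at h
  refine ⟨fun h => ?_, key g⟩
  simpa [mul_assoc] using key g⁻¹ h

theorem ConjClosedF.sum_mul_comm {G M : Type*} [Group G] [DecidableEq G] [AddCommMonoid M]
    {T : Finset G} (hT : ConjClosedF T) (f : G → M) (g : G) :
    ∑ t ∈ T, f (t * g) = ∑ t ∈ T, f (g * t) := by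
  refine Finset.sum_bij' (fun t _ => g⁻¹ * t * g) (fun t _ => g * t * g⁻¹)
    (fun t ht => (hT.conj_mem_iff g t).2 ht)
    (fun t ht => by simpa using (hT.conj_mem_iff g⁻¹ t).2 ht) ?_ ?_ ?_ <;>
  simp [mul_assoc]

/-- No subspaces other than `⊥` and `⊤` are invariant under `ρ`. -/
def Representation.OnlyTrivialInvariant {G V : Type*} [Group G] [AddCommGroup V] [Module ℂ V]
    (ρ : Representation ℂ G V) : Prop :=
  ∀ W : Submodule ℂ V, (∀ g : G, ∀ v ∈ W, ρ g v ∈ W) → W = ⊥ ∨ W = ⊤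

/-- Schur's lemma for the sum of a representation over a conjugation-closed set. -/
theorem Representation.OnlyTrivialInvariant.exists_sum_eq_smul {G V : Type*} [Group G]
    [DecidableEq G] [AddCommGroup V] [Module ℂ V] [FiniteDimensional ℂ V] [Nontrivial V]
    {ρ : Representation ℂ G V} (hρ : ρ.OnlyTrivialInvariant) {T : Finset G}
    (hT : ConjClosedF T) : ∃ μ : ℂ, ∑ t ∈ T, ρ t = μ • 1 := by
  obtain ⟨μ, hμ⟩ := Module.End.exists_eigenvalue (∑ t ∈ T, ρ t)
  have hcomm (g : G) : (∑ t ∈ T, ρ t) * ρ g = ρ g * ∑ t ∈ T, ρ t := by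
    simp only [Finset.sum_mul, Finset.mul_sum, ← map_mul]
    exact hT.sum_mul_comm ρ g
  refine ⟨μ, ?_⟩
  have hinv (g : G) (v : V) (hv : v ∈ Module.End.eigenspace (∑ t ∈ T, ρ t) μ) :
      ρ g v ∈ Module.End.eigenspace (∑ t ∈ T, ρ t) μ := by
    rw [Module.End.mem_eigenspace_iff] at hv ⊢
    rw [← Module.End.mul_apply, hcomm, Module.End.mul_apply, hv, map_smul]
  rcases hρ _ hinv with h | h
  · exact absurd h hμ
  · ext v
    have hv : v ∈ Module.End.eigenspace (∑ t ∈ T, ρ t) μ := h ▸ Submodule.mem_top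
    simpa using Module.End.mem_eigenspace_iff.1 hv

theorem Representation.sum_trace_mul {G V : Type*} [Group G] [AddCommGroup V] [Module ℂ V]
    {ρ : Representation ℂ G V} {T : Finset G} {μ : ℂ}
    (h : ∑ t ∈ T, ρ t = μ • 1) (g : G) :
    ∑ t ∈ T, LinearMap.trace ℂ V (ρ (t * g)) = μ * LinearMap.trace ℂ V (ρ g) := by
  simp only [map_mul]
  rw [← map_sum, ← Finset.sum_mul, h, smul_mul_assoc, one_mul, map_smul, smul_eq_mul]

theorem IsIrrChar.exists_map_one_eq {G : Type*} [Group G] {χ : G → ℂ} (hχ : IsIrrChar G χ) :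
    ∃ d : ℕ, d ≠ 0 ∧ χ 1 = d := by
  obtain ⟨V, _, _, _, _, ρ, -, hρ⟩ := hχ
  refine ⟨Module.finrank ℂ V, Module.finrank_pos.ne', ?_⟩
  rw [hρ, map_one, LinearMap.trace_one]

theorem IsIrrChar.exists_sum_mul_eq {G : Type*} [Group G] [DecidableEq G] {χ : G → ℂ}
    (hχ : IsIrrChar G χ) {T : Finset G} (hT : ConjClosedF T) :
    ∃ μ : ℂ, ∀ g, ∑ t ∈ T, χ (t * g) = μ * χ g := by
  obtain ⟨V, _, _, _, _, ρ, hirr, hρ⟩ := hχ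
  obtain ⟨μ, hμ⟩ := Representation.OnlyTrivialInvariant.exists_sum_eq_smul hirr hT
  exact ⟨μ, fun g => by simp only [hρ, Representation.sum_trace_mul hμ]⟩

/-- The trace of an irreducible representation in any universe is an irreducible character. -/
theorem Representation.OnlyTrivialInvariant.isIrrChar {G V : Type*} [Group G] [AddCommGroup V]
    [Module ℂ V] [FiniteDimensional ℂ V] [Nontrivial V] {ρ : Representation ℂ G V}
    (hρ : ρ.OnlyTrivialInvariant) : IsIrrChar G (fun g => LinearMap.trace ℂ V (ρ g)) := by
  let e : V ≃ₗ[ℂ] (Fin (Module.finrank ℂ V) → ℂ) := (Module.finBasis ℂ V).equivFun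
  let σ : Representation ℂ G (Fin (Module.finrank ℂ V) → ℂ) :=
    (e.conjRingEquiv : _ →* _).comp ρ
  have hσ (g : G) : σ g = e.conj (ρ g) := rfl
  refine ⟨_, inferInstance, inferInstance, inferInstance, e.symm.toEquiv.nontrivial, σ, ?_, ?_⟩
  · intro W hW
    have := hρ (W.comap e.toLinearMap) fun g v hv => by
      simpa [hσ, LinearEquiv.conj_apply] using hW g (e v) hv
    rcases this with h | h
    · left
      have := congrArg (Submodule.map e.toLinearMap) h
      rwa [Submodule.map_comap_eq_of_surjective e.surjective, Submodule.map_bot] at this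
    · right
      have := congrArg (Submodule.map e.toLinearMap) h
      rwa [Submodule.map_comap_eq_of_surjective e.surjective, Submodule.map_top,
        LinearEquiv.range] at this
  · intro g
    rw [hσ, LinearMap.trace_conj']

theorem Representation.exists_minimal_invariant {G V : Type*} [Group G] [AddCommGroup V]
    [Module ℂ V] [FiniteDimensional ℂ V] (ρ : Representation ℂ G V) (E : Submodule ℂ V)
    (hE : E ≠ ⊥) (hinv : ∀ g, ∀ v ∈ E, ρ g v ∈ E) :
    ∃ W ≤ E, W ≠ ⊥ ∧ (∀ g, ∀ v ∈ W, ρ g v ∈ W) ∧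
      ∀ W' ≤ W, W' ≠ ⊥ → (∀ g, ∀ v ∈ W', ρ g v ∈ W') → W' = W := by
  obtain ⟨W, ⟨hWE, hW, hWinv⟩, hmin⟩ := WellFounded.has_min (wellFounded_lt (α := Submodule ℂ V))
    {W | W ≤ E ∧ W ≠ ⊥ ∧ ∀ g, ∀ v ∈ W, ρ g v ∈ W} ⟨E, le_rfl, hE, hinv⟩
  refine ⟨W, hWE, hW, hWinv, fun W' hle hne hinv' => ?_⟩
  by_contra h
  exact hmin W' ⟨hle.trans hWE, hne, hinv'⟩ (lt_of_le_of_ne hle h)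

/-- Every nonzero invariant subspace contains a nonzero vector on which all sums over
conjugation-closed sets act by the scalars of a common irreducible character. -/
theorem Representation.exists_irrChar_of_invariant {G V : Type*} [Group G] [DecidableEq G]
    [AddCommGroup V] [Module ℂ V] [FiniteDimensional ℂ V] (ρ : Representation ℂ G V)
    (E : Submodule ℂ V) (hE : E ≠ ⊥) (hinv : ∀ g, ∀ v ∈ E, ρ g v ∈ E) :
    ∃ χ, IsIrrChar G χ ∧ ∃ v ∈ E, v ≠ 0 ∧ ∀ T : Finset G, ConjClosedF T →
      ∃ μ : ℂ, (∀ g, ∑ t ∈ T, χ (t * g) = μ * χ g) ∧ ∑ t ∈ T, ρ t v = μ • v := by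
  obtain ⟨W, hWE, hW, hWinv, hmin⟩ := ρ.exists_minimal_invariant E hE hinv
  let σ : Representation ℂ G W :=
    { toFun := fun g => (ρ g).restrict (hWinv g)
      map_one' := by ext; simp
      map_mul' := fun g h => by ext; simp }
  have hσ (g : G) (w : W) : (σ g w : V) = ρ g w := rfl
  have : Nontrivial W := Submodule.nontrivial_iff_ne_bot.2 hW
  have hirr : σ.OnlyTrivialInvariant := by
    intro U hU
    by_cases h : U = ⊥
    · exact Or.inl h
    · right
      have hm := hmin (U.map W.subtype) (Submodule.map_subtype_le W U)
        (fun h0 => h (Submodule.map_injective_of_injective W.subtype_injective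
          (h0.trans (Submodule.map_bot _).symm))) (by
          rintro g _ ⟨u, hu, rfl⟩
          exact ⟨σ g u, hU g u hu, rfl⟩)
      apply Submodule.map_injective_of_injective W.subtype_injective
      rw [hm, Submodule.map_top, Submodule.range_subtype]
  obtain ⟨v, hv, hv0⟩ := Submodule.exists_mem_ne_zero_of_ne_bot hW
  refine ⟨_, hirr.isIrrChar, v, hWE hv, hv0, fun T hT => ?_⟩
  obtain ⟨μ, hμ⟩ := hirr.exists_sum_eq_smul hT
  refine ⟨μ, Representation.sum_trace_mul hμ, ?_⟩
  have h := congrArg (Subtype.val) (LinearMap.congr_fun hμ ⟨v, hv⟩)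
  simpa [hσ] using h

/-- Right translation on functions on two copies of a group. -/
def sumRightRegular (G : Type*) [Group G] : Representation ℂ G (G ⊕ G → ℂ) where
  toFun g := LinearMap.funLeft ℂ ℂ (Sum.map (· * g) (· * g))
  map_one' := by ext f x; cases x <;> simp [LinearMap.funLeft]
  map_mul' g h := by ext f x; cases x <;> simp [LinearMap.funLeft, mul_assoc]

@[simp] theorem sumRightRegular_inl {G : Type*} [Group G] (g h : G) (f : G ⊕ G → ℂ) :
    sumRightRegular G g f (Sum.inl h) = f (Sum.inl (h * g)) := rfl

@[simp] theorem sumRightRegular_inr {G : Type*} [Group G] (g h : G) (f : G ⊕ G → ℂ) :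
    sumRightRegular G g f (Sum.inr h) = f (Sum.inr (h * g)) := rfl

theorem sum_ite_mul_inv_mem {G : Type*} [Group G] [Fintype G] [DecidableEq G] (T : Finset G)
    (f : G → ℂ) (h : G) : ∑ g, (if g * h⁻¹ ∈ T then f g else 0) = ∑ t ∈ T, f (t * h) := by
  rw [← Equiv.sum_comp (Equiv.mulRight h)]
  simp [Finset.sum_ite_mem]

section scMatrix

variable {G : Type*} [Group G] [Fintype G] [DecidableEq G] (T11 T22 T12 T21 : Finset G)

theorem scMatrix_mulVec_inl (f : G ⊕ G → ℂ) (h : G) :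
    ((scMatrix T11 T22 T12 T21).map (algebraMap ℚ ℂ)).mulVec f (Sum.inl h) =
      ∑ t ∈ T11, f (Sum.inl (t * h)) + ∑ t ∈ T12, f (Sum.inr (t * h)) := by
  rw [← sum_ite_mul_inv_mem T11 (fun g => f (Sum.inl g)),
    ← sum_ite_mul_inv_mem T12 (fun g => f (Sum.inr g))]
  simp [Matrix.mulVec, dotProduct, scMatrix, apply_ite (Rat.cast : ℚ → ℂ)]

theorem scMatrix_mulVec_inr (f : G ⊕ G → ℂ) (h : G) :
    ((scMatrix T11 T22 T12 T21).map (algebraMap ℚ ℂ)).mulVec f (Sum.inr h) =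
      ∑ t ∈ T21, f (Sum.inl (t * h)) + ∑ t ∈ T22, f (Sum.inr (t * h)) := by
  rw [← sum_ite_mul_inv_mem T21 (fun g => f (Sum.inl g)),
    ← sum_ite_mul_inv_mem T22 (fun g => f (Sum.inr g))]
  simp [Matrix.mulVec, dotProduct, scMatrix, apply_ite (Rat.cast : ℚ → ℂ)]

end scMatrix

theorem Matrix.aeval_charpoly_eq_zero_iff {n : Type*} [Fintype n] [DecidableEq n]
    (A : Matrix n n ℚ) (z : ℂ) : Polynomial.aeval z A.charpoly = 0 ↔
      ∃ v : n → ℂ, v ≠ 0 ∧ (A.map (algebraMap ℚ ℂ)).mulVec v = z • v := by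
  rw [Polynomial.aeval_def, ← Polynomial.eval_map, ← Matrix.charpoly_map, Matrix.eval_charpoly,
    ← Matrix.exists_mulVec_eq_zero_iff]
  refine exists_congr fun v => and_congr_right fun _ => ?_
  rw [Matrix.sub_mulVec, sub_eq_zero, Matrix.scalar_apply, ← Matrix.smul_one_eq_diagonal,
    Matrix.smul_mulVec, Matrix.one_mulVec, eq_comm]

theorem exists_irrChar_of_aeval_charpoly_scMatrix {G : Type*} [Group G] [Fintype G]
    [DecidableEq G] {T11 T22 T12 T21 : Finset G}
    (h11 : ConjClosedF T11) (h22 : ConjClosedF T22)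
    (h12 : ConjClosedF T12) (h21 : ConjClosedF T21) {z : ℂ}
    (hz : Polynomial.aeval z (scMatrix T11 T22 T12 T21).charpoly = 0) :
    ∃ χ, IsIrrChar G χ ∧ ∃ a b c d : ℂ,
      (∀ g, ∑ t ∈ T11, χ (t * g) = a * χ g) ∧ (∀ g, ∑ t ∈ T22, χ (t * g) = b * χ g) ∧
      (∀ g, ∑ t ∈ T12, χ (t * g) = c * χ g) ∧ (∀ g, ∑ t ∈ T21, χ (t * g) = d * χ g) ∧
      (z - a) * (z - b) = c * d := by
  obtain ⟨v, hv0, hv⟩ := (Matrix.aeval_charpoly_eq_zero_iff _ _).1 hz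
  set E := Module.End.eigenspace
    (Matrix.mulVecLin ((scMatrix T11 T22 T12 T21).map (algebraMap ℚ ℂ))) z with hE
  have mem_E (f : G ⊕ G → ℂ) : f ∈ E ↔
      (∀ h, ∑ t ∈ T11, f (Sum.inl (t * h)) + ∑ t ∈ T12, f (Sum.inr (t * h))
        = z * f (Sum.inl h)) ∧
      ∀ h, ∑ t ∈ T21, f (Sum.inl (t * h)) + ∑ t ∈ T22, f (Sum.inr (t * h))
        = z * f (Sum.inr h) := by
    simp only [hE, Module.End.mem_eigenspace_iff, Matrix.mulVecLin_apply, funext_iff, Sum.forall,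
      scMatrix_mulVec_inl, scMatrix_mulVec_inr, Pi.smul_apply, smul_eq_mul]
  obtain ⟨χ, hχ, w, hwE, hw0, hw⟩ := (sumRightRegular G).exists_irrChar_of_invariant E
    (fun h => hv0 ((Submodule.eq_bot_iff E).1 h v (Module.End.mem_eigenspace_iff.2 hv)))
    (fun g f hf => by
      rw [mem_E] at hf ⊢
      simpa [mul_assoc] using And.intro (fun h => hf.1 (h * g)) (fun h => hf.2 (h * g)))
  obtain ⟨a, ha, ha'⟩ := hw T11 h11
  obtain ⟨b, hb, hb'⟩ := hw T22 h22
  obtain ⟨c, hc, hc'⟩ := hw T12 h12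
  obtain ⟨d, hd, hd'⟩ := hw T21 h21
  refine ⟨χ, hχ, a, b, c, d, ha, hb, hc, hd, ?_⟩
  simp only [funext_iff, Sum.forall, Finset.sum_apply, sumRightRegular_inl, sumRightRegular_inr,
    Pi.smul_apply, smul_eq_mul] at ha' hb' hc' hd'
  obtain ⟨h1, h2⟩ := (mem_E w).1 hwE
  simp only [h11.sum_mul_comm (fun g => w (Sum.inl g)), h12.sum_mul_comm (fun g => w (Sum.inr g)),
    ha'.1, hc'.2] at h1
  simp only [h21.sum_mul_comm (fun g => w (Sum.inl g)), h22.sum_mul_comm (fun g => w (Sum.inr g)),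
    hd'.1, hb'.2] at h2
  by_contra hne
  apply hw0
  rw [← sub_eq_zero] at hne
  ext x
  rcases x with h | h
  · refine (mul_eq_zero.1 ?_).resolve_left hne
    linear_combination (-(z - b)) * h1 h - c * h2 h
  · refine (mul_eq_zero.1 ?_).resolve_left hne
    linear_combination (-(z - a)) * h2 h - d * h1 h

theorem exists_ne_zero_of_mul_eq_mul {z a b c d : ℂ} (h : (z - a) * (z - b) = c * d) :
    ∃ x y : ℂ, (x ≠ 0 ∨ y ≠ 0) ∧ a * x + c * y = z * x ∧ d * x + b * y = z * y := by
  by_cases hc : c = 0 ∧ z - a = 0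
  · by_cases hd : z - b = 0 ∧ d = 0
    · exact ⟨1, 0, by simp, by linear_combination -hc.2, by linear_combination hd.2⟩
    · refine ⟨z - b, d, ?_, by linear_combination -h, by ring⟩
      simpa [or_iff_not_and_not] using hd
  · refine ⟨c, z - a, ?_, by ring, by linear_combination -h⟩
    simpa [or_iff_not_and_not] using hc

theorem aeval_charpoly_scMatrix_eq_zero {G : Type*} [Group G] [Fintype G]
    [DecidableEq G] {T11 T22 T12 T21 : Finset G} {χ : G → ℂ} (hχ : χ 1 ≠ 0) {z a b c d : ℂ}
    (ha : ∀ g, ∑ t ∈ T11, χ (t * g) = a * χ g) (hb : ∀ g, ∑ t ∈ T22, χ (t * g) = b * χ g)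
    (hc : ∀ g, ∑ t ∈ T12, χ (t * g) = c * χ g) (hd : ∀ g, ∑ t ∈ T21, χ (t * g) = d * χ g)
    (h : (z - a) * (z - b) = c * d) :
    Polynomial.aeval z (scMatrix T11 T22 T12 T21).charpoly = 0 := by
  obtain ⟨x, y, hxy, h1, h2⟩ := exists_ne_zero_of_mul_eq_mul h
  rw [Matrix.aeval_charpoly_eq_zero_iff]
  refine ⟨Sum.elim (fun g => x * χ g) (fun g => y * χ g), fun h0 => ?_, ?_⟩
  · have hx := congrFun h0 (Sum.inl 1)
    have hy := congrFun h0 (Sum.inr 1)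
    simp_all
  · ext g
    rcases g with g | g
    · simp only [scMatrix_mulVec_inl, Sum.elim_inl, Sum.elim_inr, ← Finset.mul_sum, ha, hc,
        Pi.smul_apply, smul_eq_mul]
      linear_combination χ g * h1
    · simp only [scMatrix_mulVec_inr, Sum.elim_inl, Sum.elim_inr, ← Finset.mul_sum, hb, hd,
        Pi.smul_apply, smul_eq_mul]
      linear_combination χ g * h2

theorem sum_map_msProd {G : Type*} [Group G] {X Y : Finset G} {χ : G → ℂ} {μ ν : ℂ}
    (hX : ∀ g, ∑ t ∈ X, χ (t * g) = μ * χ g) (hY : ∀ g, ∑ t ∈ Y, χ (t * g) = ν * χ g) :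
    ((msProd X.val Y.val).map χ).sum = μ * ν * χ 1 := by
  have h : ((msProd X.val Y.val).map χ).sum = ∑ x ∈ X, ∑ y ∈ Y, χ (x * y) := by
    simp [msProd, Multiset.map_bind, Multiset.sum_bind]
  have hY1 := hY 1
  simp only [mul_one] at hY1
  rw [h, Finset.sum_comm]
  simp only [hX, ← Finset.mul_sum, hY1]
  ring

theorem Multiset.sum_map_sub_sub_sum_map_sub {α M : Type*} [DecidableEq α] [AddCommGroup M]
    (s t : Multiset α) (f : α → M) :
    ((s - t).map f).sum - ((t - s).map f).sum = (s.map f).sum - (t.map f).sum := by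
  have hs := congrArg (fun u => (u.map f).sum) (Multiset.sub_add_inter s t)
  have ht := congrArg (fun u => (u.map f).sum) (Multiset.sub_add_inter t s)
  simp only [Multiset.map_add, Multiset.sum_add, Multiset.inter_comm t s] at hs ht
  rw [← hs, ← ht, add_sub_add_right_eq_sub]

theorem stmt_11 {G : Type*} [Group G] [Fintype G] [DecidableEq G]
    (T11 T22 T12 T21 : Finset G)
    (h11 : ConjClosedF T11) (h22 : ConjClosedF T22)
    (h12 : ConjClosedF T12) (h21 : ConjClosedF T21)
    (I1 I2 I3 : Multiset G)
    (hI1 : I1 = T11.val + T22.val)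
    (hI2 : I2 = msProd T11.val T11.val + msProd T22.val T22.val + 4 • msProd T12.val T21.val)
    (hI3 : I3 = 2 • msProd T11.val T22.val) :
    IntermediateField.adjoin ℚ
        {z : ℂ | Polynomial.aeval z (scMatrix T11 T22 T12 T21).charpoly = 0}
      = IntermediateField.adjoin ℚ
        ({z : ℂ | ∃ χ : G → ℂ, IsIrrChar G χ ∧ z = (I1.map χ).sum}
          ∪ {z : ℂ | ∃ χ : G → ℂ, IsIrrChar G χ ∧
              z ^ 2 = χ 1 * (((I2 - I3).map χ).sum - ((I3 - I2).map χ).sum)}) := by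
  have hsum {χ : G → ℂ} {a b c d : ℂ}
      (ha : ∀ g, ∑ t ∈ T11, χ (t * g) = a * χ g) (hb : ∀ g, ∑ t ∈ T22, χ (t * g) = b * χ g)
      (hc : ∀ g, ∑ t ∈ T12, χ (t * g) = c * χ g) (hd : ∀ g, ∑ t ∈ T21, χ (t * g) = d * χ g) :
      (I1.map χ).sum = (a + b) * χ 1 ∧
      χ 1 * (((I2 - I3).map χ).sum - ((I3 - I2).map χ).sum)
        = χ 1 ^ 2 * ((a - b) ^ 2 + 4 * (c * d)) := by
    constructor
    · have ha1 := ha 1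
      have hb1 := hb 1
      simp only [mul_one, Finset.sum] at ha1 hb1
      rw [hI1, Multiset.map_add, Multiset.sum_add, ha1, hb1, add_mul]
    · rw [Multiset.sum_map_sub_sub_sum_map_sub, hI2, hI3]
      simp only [Multiset.map_add, Multiset.sum_add, Multiset.map_nsmul, Multiset.sum_nsmul,
        sum_map_msProd ha ha, sum_map_msProd hb hb, sum_map_msProd ha hb, sum_map_msProd hc hd,
        nsmul_eq_mul]
      push_cast
      ring
  apply le_antisymm
  · rw [IntermediateField.adjoin_le_iff]
    intro z hz
    obtain ⟨χ, hχ, a, b, c, d, ha, hb, hc, hd, h⟩ :=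
      exists_irrChar_of_aeval_charpoly_scMatrix h11 h22 h12 h21 hz
    obtain ⟨n, hn, hn1⟩ := hχ.exists_map_one_eq
    have hn' : (n : ℂ) ≠ 0 := Nat.cast_ne_zero.2 hn
    obtain ⟨hs1, hs2⟩ := hsum ha hb hc hd
    set K := IntermediateField.adjoin ℚ
        ({z : ℂ | ∃ χ : G → ℂ, IsIrrChar G χ ∧ z = (I1.map χ).sum}
          ∪ {z : ℂ | ∃ χ : G → ℂ, IsIrrChar G χ ∧
              z ^ 2 = χ 1 * (((I2 - I3).map χ).sum - ((I3 - I2).map χ).sum)})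
    have hx : (a + b) * n ∈ K :=
      IntermediateField.subset_adjoin _ _ (Or.inl ⟨χ, hχ, by rw [hs1, hn1]⟩)
    have hy : n * (2 * z - a - b) ∈ K := by
      refine IntermediateField.subset_adjoin _ _ (Or.inr ⟨χ, hχ, ?_⟩)
      rw [hs2, hn1]
      linear_combination 4 * (n : ℂ) ^ 2 * h
    have hz' : z = ((a + b) * n + n * (2 * z - a - b)) / ((2 * n : ℕ) : ℂ) := by
      push_cast
      field_simp
      ring
    rw [SetLike.mem_coe, hz']
    exact div_mem (add_mem hx hy) (_root_.natCast_mem K _)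
  · rw [IntermediateField.adjoin_le_iff]
    set K := IntermediateField.adjoin ℚ
        {z : ℂ | Polynomial.aeval z (scMatrix T11 T22 T12 T21).charpoly = 0}
    have key {χ : G → ℂ} (hχ : IsIrrChar G χ) {w : ℂ}
        (hw : w ^ 2 = χ 1 * (((I2 - I3).map χ).sum - ((I3 - I2).map χ).sum)) :
        (I1.map χ).sum ∈ K ∧ w ∈ K := by
      obtain ⟨n, hn, hn1⟩ := hχ.exists_map_one_eq
      have hn' : (n : ℂ) ≠ 0 := Nat.cast_ne_zero.2 hn
      obtain ⟨a, ha⟩ := hχ.exists_sum_mul_eq h11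
      obtain ⟨b, hb⟩ := hχ.exists_sum_mul_eq h22
      obtain ⟨c, hc⟩ := hχ.exists_sum_mul_eq h12
      obtain ⟨d, hd⟩ := hχ.exists_sum_mul_eq h21
      obtain ⟨hs1, hs2⟩ := hsum ha hb hc hd
      obtain ⟨s, rfl⟩ : ∃ s, w = n * s := ⟨w / n, by field_simp⟩
      rw [hs2, hn1, mul_pow] at hw
      have hs := mul_left_cancel₀ (pow_ne_zero 2 hn') hw
      have hroot {z : ℂ} (h : (z - a) * (z - b) = c * d) : z ∈ K :=
        IntermediateField.subset_adjoin _ _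
          (aeval_charpoly_scMatrix_eq_zero (hn1 ▸ hn') ha hb hc hd h)
      have hp : (a + b + s) / 2 ∈ K := hroot (by linear_combination hs / 4)
      have hm : (a + b - s) / 2 ∈ K := hroot (by linear_combination hs / 4)
      rw [hs1, hn1]
      constructor
      · convert mul_mem (add_mem hp hm) (_root_.natCast_mem K n) using 1
        ring
      · convert mul_mem (_root_.natCast_mem K n) (sub_mem hp hm) using 1
        ring
    rintro z (⟨χ, hχ, rfl⟩ | ⟨χ, hχ, hz⟩)
    · obtain ⟨w, hw⟩ := IsAlgClosed.exists_pow_nat_eq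
        (χ 1 * (((I2 - I3).map χ).sum - ((I3 - I2).map χ).sum)) two_pos
      exact (key hχ hw).1
    · exact (key hχ hz).2
end

section
/- Let G be a finite group of exponent m and let Γ = SC(G, T₁₁, T₂₂, T₁₂, T₂₁) be a quasi-abelian semi-Cayley digraph with adjacency matrix A (a matrix over ℚ with 0/1 entries), and I₁, I₂, I₃, T, K, M as below. Then the algebraic degree deg(Γ) = [SF(Γ) : ℚ] of Γ satisfies deg(Γ)·|T| = φ(m)·|M|, where φ is Euler's totient function. -/
open IntermediateField

/-- The `t`-th power map on multisets of a group, for `t` a unit modulo the exponent. -/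
def msPow {G : Type*} [Group G] {m : ℕ} (t : (ZMod m)ˣ) (X : Multiset G) : Multiset G :=
  X.map (fun x => x ^ ((t : ZMod m).val))

theorem Module.End.exists_trace_pow_eq_sum {V : Type*} [AddCommGroup V] [Module ℂ V]
    [FiniteDimensional ℂ V] (f : Module.End ℂ V) {m : ℕ} (hm : 0 < m) (hf : f ^ m = 1) :
    ∃ (s : Finset ℂ) (d : ℂ → ℕ), (∀ μ ∈ s, μ ^ m = 1) ∧
      ∀ k : ℕ, LinearMap.trace ℂ V (f ^ k) = ∑ μ ∈ s, d μ * μ ^ k := by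
  classical
  have hss : f.IsSemisimple := by
    apply Module.End.isSemisimple_of_squarefree_aeval_eq_zero
      (p := (Polynomial.X ^ m - 1 : Polynomial ℂ))
    · exact (Polynomial.X_pow_sub_one_separable_iff.mpr (by exact_mod_cast hm.ne')).squarefree
    · simp [hf]
  have hinternal : DirectSum.IsInternal (fun μ => f.eigenspace μ) := by
    apply DirectSum.isInternal_submodule_of_iSupIndep_of_iSup_eq_top f.eigenspaces_iSupIndep
    rw [← Module.End.iSup_maxGenEigenspace_eq_top f]
    exact iSup_congr fun μ => (hss.isFinitelySemisimple.maxGenEigenspace_eq_eigenspace μ).symm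
  have hfin : {μ | f.eigenspace μ ≠ ⊥}.Finite :=
    WellFoundedGT.finite_ne_bot_of_iSupIndep f.eigenspaces_iSupIndep
  refine ⟨hfin.toFinset, fun μ => Module.finrank ℂ (f.eigenspace μ), ?_, ?_⟩
  · intro μ hμ
    have hμ' : f.HasEigenvalue μ := by
      rw [Set.Finite.mem_toFinset] at hμ
      exact hμ
    obtain ⟨v, hv⟩ := hμ'.exists_hasEigenvector
    have h := hv.pow_apply m
    rw [hf, Module.End.one_apply] at h
    have h2 : (μ ^ m - 1) • v = 0 := by rw [sub_smul, one_smul, ← h, sub_self]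
    exact sub_eq_zero.mp ((smul_eq_zero.mp h2).resolve_right hv.2)
  · intro k
    have hmaps : ∀ μ, Set.MapsTo (f ^ k) (f.eigenspace μ) (f.eigenspace μ) := by
      intro μ v hv
      exact Module.End.mapsTo_genEigenspace_of_comm ((Commute.refl f).pow_right k) μ 1 hv
    rw [LinearMap.trace_eq_sum_trace_restrict' hinternal hfin hmaps]
    refine Finset.sum_congr rfl fun μ _ => ?_
    have : (f ^ k).restrict (hmaps μ) = μ ^ k • LinearMap.id := by
      ext v
      have hv : f v = μ • (v : V) := Module.End.mem_eigenspace_iff.mp v.2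
      have : ∀ n : ℕ, (f ^ n) v = μ ^ n • (v : V) := by
        intro n
        induction n with
        | zero => simp
        | succ n ih => rw [pow_succ', Module.End.mul_apply, ih, map_smul, hv, smul_smul, pow_succ]
      exact this k
    rw [this, map_smul, LinearMap.trace_id, smul_eq_mul, mul_comm]

/-- A nonzero invariant subspace of a finite-dimensional complex representation contains a
nonzero irreducible one. -/
theorem Representation.exists_irreducible_invariant_le {G : Type*} [Group G]
    {W : Type*} [AddCommGroup W] [Module ℂ W] [FiniteDimensional ℂ W]
    (ρ : Representation ℂ G W) (U₀ : Submodule ℂ W) (hU₀ : U₀ ≠ ⊥)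
    (hinv₀ : ∀ g, ∀ v ∈ U₀, ρ g v ∈ U₀) :
    ∃ U ≤ U₀, U ≠ ⊥ ∧ (∀ g, ∀ v ∈ U, ρ g v ∈ U) ∧
      ∀ U' ≤ U, (∀ g, ∀ v ∈ U', ρ g v ∈ U') → U' = ⊥ ∨ U' = U := by
  obtain ⟨U, ⟨hle, hU, hinv⟩, hmin⟩ := (wellFounded_lt (α := Submodule ℂ W)).has_min
    {U | U ≤ U₀ ∧ U ≠ ⊥ ∧ ∀ g, ∀ v ∈ U, ρ g v ∈ U} ⟨U₀, le_rfl, hU₀, hinv₀⟩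
  refine ⟨U, hle, hU, hinv, fun U' hle' hU' => ?_⟩
  by_contra! h
  exact hmin U' ⟨hle'.trans hle, h.1, hU'⟩ (lt_of_le_of_ne hle' h.2)

theorem isIrrChar_trace {G : Type*} [Group G]
    {V : Type*} [AddCommGroup V] [Module ℂ V] [FiniteDimensional ℂ V] [Nontrivial V]
    (ρ : Representation ℂ G V)
    (hρ : ∀ W : Submodule ℂ V, (∀ g : G, ∀ v ∈ W, ρ g v ∈ W) → W = ⊥ ∨ W = ⊤) :
    IsIrrChar G (fun g => LinearMap.trace ℂ V (ρ g)) := by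
  let e : V ≃ₗ[ℂ] (Fin (Module.finrank ℂ V) → ℂ) := (Module.finBasis ℂ V).equivFun
  let σ : Representation ℂ G (Fin (Module.finrank ℂ V) → ℂ) :=
    { toFun := fun g => e.conj (ρ g)
      map_one' := by ext; simp [LinearEquiv.conj_apply]
      map_mul' := fun g h => by
        apply LinearMap.ext; intro; simp [LinearEquiv.conj_apply] }
  refine ⟨_, inferInstance, inferInstance, inferInstance, e.symm.toEquiv.nontrivial, σ, ?_, ?_⟩
  · intro W hW
    have h := hρ (W.comap e.toLinearMap) (fun g v hv => by
      have := hW g (e v) hv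
      simpa [σ, LinearEquiv.conj_apply] using this)
    have hWe : W = (W.comap e.toLinearMap).map e.toLinearMap :=
      (Submodule.map_comap_eq_of_surjective e.surjective W).symm
    rcases h with h | h
    · left; rw [hWe, h, Submodule.map_bot]
    · right; rw [hWe, h, Submodule.map_top]; exact LinearEquiv.range e
  · intro g
    exact (LinearMap.trace_conj' (ρ g) e).symm

theorem Representation.eq_smul_one_of_commute {G : Type*} [Group G]
    {V : Type*} [AddCommGroup V] [Module ℂ V] [FiniteDimensional ℂ V] [Nontrivial V]
    (ρ : Representation ℂ G V)
    (hρ : ∀ W : Submodule ℂ V, (∀ g : G, ∀ v ∈ W, ρ g v ∈ W) → W = ⊥ ∨ W = ⊤)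
    (c : Module.End ℂ V) (hc : ∀ g, Commute c (ρ g)) :
    c = (LinearMap.trace ℂ V c / LinearMap.trace ℂ V (ρ 1)) • (1 : Module.End ℂ V) := by
  obtain ⟨μ, hμ⟩ := Module.End.exists_eigenvalue c
  have htop : c.eigenspace μ = ⊤ := by
    refine (hρ _ fun g v hv => ?_).resolve_left hμ
    rw [Module.End.mem_eigenspace_iff] at hv ⊢
    rw [← Module.End.mul_apply, (hc g).eq, Module.End.mul_apply, hv, map_smul]
  have hcμ : c = μ • (1 : Module.End ℂ V) := by
    ext v
    have : v ∈ c.eigenspace μ := htop ▸ Submodule.mem_top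
    simpa using Module.End.mem_eigenspace_iff.mp this
  have hd : (Module.finrank ℂ V : ℂ) ≠ 0 := by
    exact_mod_cast (Module.finrank_pos (R := ℂ) (M := V)).ne'
  rw [hcμ, map_smul, map_one ρ, LinearMap.trace_one, smul_eq_mul, mul_div_cancel_right₀ _ hd]

theorem IsIrrChar.exists_natCast {G : Type*} [Group G] {χ : G → ℂ} (hχ : IsIrrChar G χ) :
    ∃ d : ℕ, 0 < d ∧ χ 1 = d := by
  obtain ⟨V, _, _, _, _, ρ, -, h⟩ := hχ
  exact ⟨Module.finrank ℂ V, Module.finrank_pos, by rw [h, map_one, LinearMap.trace_one]⟩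

theorem IsIrrChar.apply_one_ne_zero {G : Type*} [Group G] {χ : G → ℂ} (hχ : IsIrrChar G χ) :
    χ 1 ≠ 0 := by
  obtain ⟨d, hd, h⟩ := hχ.exists_natCast
  rw [h]; exact_mod_cast hd.ne'

/-- The sum of a class function against a representation commutes with the representation. -/
theorem Representation.commute_sum_smul {G : Type*} [Group G] [Fintype G]
    {V : Type*} [AddCommGroup V] [Module ℂ V] (ρ : Representation ℂ G V)
    (F : G → ℂ) (hF : ∀ g x, F (g⁻¹ * x * g) = F x) (h : G) :
    Commute (∑ g, F g • ρ g) (ρ h) := by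
  rw [commute_iff_eq, Finset.sum_mul, Finset.mul_sum]
  refine Fintype.sum_equiv (MulAut.conj h⁻¹).toEquiv _ _ fun x => ?_
  simp only [MulEquiv.toEquiv_eq_coe, EquivLike.coe_coe, MulAut.conj_apply, inv_inv, hF,
    smul_mul_assoc, mul_smul_comm, ← map_mul]
  congr 2
  group

/-- Every nonzero invariant subspace contains a nonzero vector on which class functions act
through the central character of some irreducible character. -/
theorem Representation.exists_irrChar_smul {G : Type*} [Group G] [Fintype G]
    {W : Type*} [AddCommGroup W] [Module ℂ W] [FiniteDimensional ℂ W]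
    (ρ : Representation ℂ G W) (U₀ : Submodule ℂ W) (hU₀ : U₀ ≠ ⊥)
    (hinv₀ : ∀ g, ∀ v ∈ U₀, ρ g v ∈ U₀) :
    ∃ χ, IsIrrChar G χ ∧ ∃ w ∈ U₀, w ≠ 0 ∧
      ∀ F : G → ℂ, (∀ g x, F (g⁻¹ * x * g) = F x) →
        (∑ g, F g • ρ g) w = ((∑ g, F g * χ g) / χ 1) • w := by
  obtain ⟨U, hle, hU, hinv, hirr⟩ := ρ.exists_irreducible_invariant_le U₀ hU₀ hinv₀
  have : Nontrivial U := Submodule.nontrivial_iff_ne_bot.mpr hU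
  let σ : Representation ℂ G U :=
    { toFun := fun g => (ρ g).restrict (hinv g)
      map_one' := by ext; simp
      map_mul' := fun g h => by ext; simp }
  have hσ : ∀ W' : Submodule ℂ U, (∀ g : G, ∀ v ∈ W', σ g v ∈ W') → W' = ⊥ ∨ W' = ⊤ := by
    intro W' hW'
    have h := hirr (W'.map U.subtype) (Submodule.map_subtype_le U W') (by
      rintro g _ ⟨v, hv, rfl⟩
      exact ⟨σ g v, hW' g v hv, rfl⟩)
    rcases h with h | h
    · left
      apply Submodule.map_injective_of_injective U.injective_subtype
      rw [h, Submodule.map_bot]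
    · right
      apply Submodule.map_injective_of_injective U.injective_subtype
      rw [h, Submodule.map_subtype_top]
  obtain ⟨u, hu⟩ := exists_ne (0 : U)
  refine ⟨_, isIrrChar_trace σ hσ, u, hle u.2, by simpa using hu, fun F hF => ?_⟩
  have h := σ.eq_smul_one_of_commute hσ _ (σ.commute_sum_smul F hF)
  have h2 := congrArg (fun f : Module.End ℂ U => ((f u : U) : W)) h
  simp only [map_sum, map_smul, smul_eq_mul, LinearMap.smul_apply, Module.End.one_apply,
    LinearMap.sum_apply, Submodule.coe_sum, Submodule.coe_smul] at h2
  simpa [LinearMap.sum_apply, σ] using h2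

theorem IsIrrChar.exists_centralCharacter {G : Type*} [Group G] [Fintype G] {χ : G → ℂ}
    (hχ : IsIrrChar G χ) :
    ∃ f : G → ℂ, f ≠ 0 ∧ ∀ F : G → ℂ, (∀ g x, F (g⁻¹ * x * g) = F x) →
      ∀ h, ∑ g, F (g * h⁻¹) * f g = ((∑ g, F g * χ g) / χ 1) * f h := by
  obtain ⟨V, _, _, _, _, ρ, hρ, hχρ⟩ := hχ
  obtain ⟨v, hv⟩ := exists_ne (0 : V)
  obtain ⟨φ, hφ⟩ : ∃ φ : Module.Dual ℂ V, φ v ≠ 0 := by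
    by_contra! h
    exact hv ((Module.forall_dual_apply_eq_zero_iff ℂ v).mp h)
  refine ⟨fun g => φ (ρ g v), fun h => hφ (by simpa using congrFun h 1), fun F hF h => ?_⟩
  have hc := ρ.eq_smul_one_of_commute hρ _ (ρ.commute_sum_smul F hF)
  have h2 := congrArg (fun f : Module.End ℂ V => φ (f (ρ h v))) hc
  simp only [map_sum, map_smul, smul_eq_mul, LinearMap.smul_apply,
    LinearMap.sum_apply, ← hχρ, ← Module.End.mul_apply, ← map_mul, one_mul] at h2
  rw [← h2]
  refine (Fintype.sum_equiv (Equiv.mulRight h) _ _ fun g => ?_).symm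
  simp

theorem msProd_map_conj {G : Type*} [Group G] {X Y : Multiset G}
    (hX : ∀ g, X.map (fun x => g⁻¹ * x * g) = X) (hY : ∀ g, Y.map (fun x => g⁻¹ * x * g) = Y)
    (g : G) : (msProd X Y).map (fun x => g⁻¹ * x * g) = msProd X Y := by
  conv_rhs => rw [← hX g, ← hY g]
  simp [msProd, Multiset.map_bind, Multiset.bind_map, mul_assoc]

theorem IsIrrChar.sum_msProd {G : Type*} [Group G] {χ : G → ℂ}
    (hχ : IsIrrChar G χ) (X Y : Multiset G) (hX : ∀ g, X.map (fun x => g⁻¹ * x * g) = X)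
    (hY : ∀ g, Y.map (fun x => g⁻¹ * x * g) = Y) :
    ((msProd X Y).map χ).sum * χ 1 = (X.map χ).sum * (Y.map χ).sum := by
  obtain ⟨V, _, _, _, _, ρ, hρ, hχρ⟩ := id hχ
  have key : ∀ Z : Multiset G, (∀ g, Z.map (fun x => g⁻¹ * x * g) = Z) →
      (Z.map ρ).sum = ((Z.map χ).sum / χ 1) • (1 : Module.End ℂ V) := by
    intro Z hZ
    have h := ρ.eq_smul_one_of_commute hρ (Z.map ρ).sum (fun g => by
      rw [commute_iff_eq, ← Multiset.sum_map_mul_right, ← Multiset.sum_map_mul_left]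
      nth_rewrite 2 [← hZ g]
      rw [Multiset.map_map]
      congr 1
      refine Multiset.map_congr rfl fun x _ => ?_
      simp only [Function.comp_apply, ← map_mul]
      congr 1
      group)
    rw [h, map_multiset_sum, Multiset.map_map, hχρ]
    have : ⇑(LinearMap.trace ℂ V) ∘ ⇑ρ = χ := funext fun x => (hχρ x).symm
    rw [this]
  have hprod : ((msProd X Y).map ρ).sum = (X.map ρ).sum * (Y.map ρ).sum := by
    simp only [msProd, Multiset.map_bind, Multiset.sum_bind, Multiset.map_map,
      Function.comp_def, map_mul, Multiset.sum_map_mul_left, Multiset.sum_map_mul_right]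
  rw [key _ (msProd_map_conj hX hY), key X hX, key Y hY, smul_mul_smul_comm, mul_one] at hprod
  have := hχ.apply_one_ne_zero
  have h2 := smul_left_injective ℂ (one_ne_zero : (1 : Module.End ℂ V) ≠ 0) hprod
  field_simp at h2
  exact h2

/-- The representation of `G` on functions on a right `G`-set by translation. -/
def translationRep (G : Type*) [Group G] (X : Type*) [MulAction Gᵐᵒᵖ X] :
    Representation ℂ G (X → ℂ) where
  toFun x := LinearMap.funLeft ℂ ℂ (fun p => MulOpposite.op x • p)
  map_one' := by ext; simp [LinearMap.funLeft]
  map_mul' x y := by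
    apply LinearMap.ext; intro f; funext p
    simp [LinearMap.funLeft, mul_smul]

theorem translationRep_apply {G : Type*} [Group G] {X : Type*} [MulAction Gᵐᵒᵖ X]
    (x : G) (f : X → ℂ) (p : X) :
    translationRep G X x f p = f (MulOpposite.op x • p) := rfl

theorem Matrix.mulVec_translationRep {G : Type*} [Group G] {X : Type*} [Fintype X]
    [MulAction Gᵐᵒᵖ X] (P : Matrix X X ℂ)
    (hP : ∀ (x : G) p q, P (MulOpposite.op x • p) (MulOpposite.op x • q) = P p q)
    (x : G) (f : X → ℂ) :
    P.mulVec (translationRep G X x f) = translationRep G X x (P.mulVec f) := by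
  funext p
  simp only [translationRep_apply, Matrix.mulVec, dotProduct]
  exact Fintype.sum_equiv (MulAction.toPerm (MulOpposite.op x)) _ _ fun q => by
    rw [MulAction.toPerm_apply, hP]

/-- An equivariant matrix preserves a nonzero eigenspace, which contains a vector on which
class functions act through a central character. -/
theorem Matrix.exists_irrChar_eigenvector {G : Type*} [Group G] [Fintype G] {X : Type*}
    [Fintype X] [DecidableEq X] [MulAction Gᵐᵒᵖ X] (P : Matrix X X ℂ)
    (hP : ∀ (x : G) p q, P (MulOpposite.op x • p) (MulOpposite.op x • q) = P p q)
    (z : ℂ) (hz : P.charpoly.IsRoot z) :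
    ∃ χ, IsIrrChar G χ ∧ ∃ w : X → ℂ, w ≠ 0 ∧ P.mulVec w = z • w ∧
      ∀ F : G → ℂ, (∀ g x, F (g⁻¹ * x * g) = F x) →
        ∀ p, ∑ g, F g * w (MulOpposite.op g • p) = ((∑ g, F g * χ g) / χ 1) * w p := by
  rw [Polynomial.IsRoot, Matrix.eval_charpoly] at hz
  obtain ⟨v, hv, hv0⟩ := Matrix.exists_mulVec_eq_zero_iff.mpr hz
  have hmem : ∀ u : X → ℂ,
      u ∈ Module.End.eigenspace P.mulVecLin z ↔ P.mulVec u = z • u := fun u => by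
    rw [Module.End.mem_eigenspace_iff, Matrix.mulVecLin_apply]
  obtain ⟨χ, hχ, w, hw, hw0, h⟩ := (translationRep G X).exists_irrChar_smul
    (Module.End.eigenspace P.mulVecLin z) (by
      rw [Submodule.ne_bot_iff]
      refine ⟨v, (hmem v).mpr ?_, hv⟩
      rw [Matrix.sub_mulVec, sub_eq_zero] at hv0
      rw [← hv0]
      simp)
    (fun g u hu => by
      rw [hmem] at hu ⊢
      rw [Matrix.mulVec_translationRep P hP, hu, map_smul])
  refine ⟨χ, hχ, w, hw0, (hmem w).mp hw, fun F hF p => ?_⟩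
  have := congrFun (h F hF) p
  simpa [LinearMap.sum_apply, Finset.sum_apply, translationRep_apply] using this

open scoped ComplexOrder in
/-- A class function orthogonal to all irreducible characters vanishes. -/
theorem eq_zero_of_forall_irrChar_sum_eq_zero {G : Type*} [Group G] [Fintype G]
    (F : G → ℂ) (hF : ∀ g x, F (g⁻¹ * x * g) = F x)
    (h : ∀ χ, IsIrrChar G χ → ∑ g, F g * χ g = 0) : F = 0 := by
  classical
  let A : Matrix G G ℂ := Matrix.of fun x y => F (x⁻¹ * y)
  have hA : ∀ (x : G) p q, A (MulOpposite.op x • p) (MulOpposite.op x • q) = A p q := by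
    intro x p q
    simp only [A, Matrix.of_apply, MulOpposite.smul_eq_mul_unop, MulOpposite.unop_op]
    rw [← hF x (p⁻¹ * q)]
    congr 1
    group
  have hB : ∀ (x : G) p q, (A.conjTranspose * A) (MulOpposite.op x • p) (MulOpposite.op x • q)
      = (A.conjTranspose * A) p q := by
    intro x p q
    simp only [Matrix.mul_apply]
    refine (Fintype.sum_equiv (MulAction.toPerm (MulOpposite.op x)) _ _ fun r => ?_).symm
    rw [MulAction.toPerm_apply, hA, Matrix.conjTranspose_apply, Matrix.conjTranspose_apply, hA]
  have hroots : ∀ z ∈ (A.conjTranspose * A).charpoly.roots, z = 0 := by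
    intro z hz
    obtain ⟨χ, hχ, w, hw0, hw, hF'⟩ :=
      Matrix.exists_irrChar_eigenvector _ hB z (Polynomial.isRoot_of_mem_roots hz)
    have hAw : A.mulVec w = 0 := by
      funext p
      have h1 := hF' F hF p
      rw [h χ hχ, zero_div, zero_mul] at h1
      rw [Pi.zero_apply, ← h1, Matrix.mulVec, dotProduct]
      refine (Fintype.sum_equiv (Equiv.mulLeft p) _ _ fun g => ?_).symm
      simp [A]
    rw [← Matrix.mulVec_mulVec, hAw, Matrix.mulVec_zero] at hw
    exact (smul_eq_zero.mp hw.symm).resolve_right hw0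
  have htr : (A.conjTranspose * A).trace = 0 := by
    rw [Matrix.trace_eq_sum_roots_charpoly]
    exact Multiset.sum_eq_zero hroots
  rw [Matrix.trace_conjTranspose_mul_self_eq_zero_iff] at htr
  funext g
  have := congrFun (congrFun htr 1) g
  simpa [A] using this

theorem Finset.val_map_conj {G : Type*} [Group G] [DecidableEq G] {T : Finset G}
    (hT : ConjClosedF T) (g : G) : T.val.map (fun x => g⁻¹ * x * g) = T.val := by
  conv_rhs => rw [← hT g]
  rw [Finset.image_val_of_injOn]
  intro x _ y _ h
  simpa using h

theorem ConjClosedF.mul_comm_mem_iff {G : Type*} [Group G] [DecidableEq G] {T : Finset G}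
    (hT : ConjClosedF T) (x y : G) : x * y ∈ T ↔ y * x ∈ T := by
  rw [← hT.conj_mem_iff x (x * y), inv_mul_cancel_left]

/-- The eigenvalues of a quasi-abelian semi-Cayley digraph are the roots of one quadratic equation
for each irreducible character. -/
theorem aeval_charpoly_scMatrix_eq_zero_iff {G : Type*} [Group G] [Fintype G] [DecidableEq G]
    {T11 T22 T12 T21 : Finset G}
    (h11 : ConjClosedF T11) (h22 : ConjClosedF T22)
    (h12 : ConjClosedF T12) (h21 : ConjClosedF T21) (z : ℂ) :
    Polynomial.aeval z (scMatrix T11 T22 T12 T21).charpoly = 0 ↔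
      ∃ χ, IsIrrChar G χ ∧
        (z - (T11.val.map χ).sum / χ 1) * (z - (T22.val.map χ).sum / χ 1) =
          (T12.val.map χ).sum / χ 1 * ((T21.val.map χ).sum / χ 1) := by
  let P : Matrix (G ⊕ G) (G ⊕ G) ℂ := (scMatrix T11 T22 T12 T21).map (algebraMap ℚ ℂ)
  have hroot : Polynomial.aeval z (scMatrix T11 T22 T12 T21).charpoly = 0 ↔
      P.charpoly.IsRoot z := by
    rw [Matrix.charpoly_map, Polynomial.IsRoot, Polynomial.eval_map_algebraMap]
  have hinl : ∀ (w : G ⊕ G → ℂ) (h : G), P.mulVec w (Sum.inl h) =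
      ∑ g, (if g * h⁻¹ ∈ T11 then 1 else 0) * w (Sum.inl g) +
        ∑ g, (if g * h⁻¹ ∈ T12 then 1 else 0) * w (Sum.inr g) := by
    intro w h
    simp [P, Matrix.mulVec, dotProduct, scMatrix, apply_ite (Rat.cast : ℚ → ℂ)]
  have hinr : ∀ (w : G ⊕ G → ℂ) (h : G), P.mulVec w (Sum.inr h) =
      ∑ g, (if g * h⁻¹ ∈ T21 then 1 else 0) * w (Sum.inl g) +
        ∑ g, (if g * h⁻¹ ∈ T22 then 1 else 0) * w (Sum.inr g) := by
    intro w h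
    simp [P, Matrix.mulVec, dotProduct, scMatrix, apply_ite (Rat.cast : ℚ → ℂ)]
  have hsum : ∀ (T : Finset G) (χ : G → ℂ),
      ∑ g, (if g ∈ T then 1 else 0) * χ g = (T.val.map χ).sum := by
    intro T χ
    simp only [ite_mul, one_mul, zero_mul, Finset.sum_ite_mem, Finset.univ_inter]
    rfl
  have hclass : ∀ {T : Finset G}, ConjClosedF T → ∀ g x : G,
      (if g⁻¹ * x * g ∈ T then (1 : ℂ) else 0) = if x ∈ T then 1 else 0 := by
    intro T hT g x
    simp only [hT.conj_mem_iff]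
  rw [hroot]
  constructor
  · intro hz
    have hP : ∀ (x : G) p q, P (MulOpposite.op x • p) (MulOpposite.op x • q) = P p q := by
      rintro x (p | p) (q | q) <;> simp [P, scMatrix]
    obtain ⟨χ, hχ, w, hw0, hw, hF⟩ := P.exists_irrChar_eigenvector hP z hz
    have hF' : ∀ {T : Finset G}, ConjClosedF T → ∀ h : G,
        (∑ g, (if g * h⁻¹ ∈ T then 1 else 0) * w (Sum.inl g) =
          (T.val.map χ).sum / χ 1 * w (Sum.inl h)) ∧
        (∑ g, (if g * h⁻¹ ∈ T then 1 else 0) * w (Sum.inr g) =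
          (T.val.map χ).sum / χ 1 * w (Sum.inr h)) := by
      intro T hT h
      rw [← hsum]
      constructor
      · rw [← hF _ (hclass hT)]
        refine (Fintype.sum_equiv (Equiv.mulLeft h) _ _ fun g => ?_).symm
        simp [hT.mul_comm_mem_iff (h * g)]
      · rw [← hF _ (hclass hT)]
        refine (Fintype.sum_equiv (Equiv.mulLeft h) _ _ fun g => ?_).symm
        simp [hT.mul_comm_mem_iff (h * g)]
    refine ⟨χ, hχ, ?_⟩
    have h1 : ∀ h, _ := fun h => congrFun hw (Sum.inl h)
    have h2 : ∀ h, _ := fun h => congrFun hw (Sum.inr h)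
    simp only [hinl, hinr, (hF' h11 _).1, (hF' h12 _).2, (hF' h21 _).1, (hF' h22 _).2,
      Pi.smul_apply, smul_eq_mul] at h1 h2
    obtain ⟨p, hp⟩ := Function.ne_iff.mp hw0
    rw [← sub_eq_zero]
    rcases p with p | p
    · refine (mul_eq_zero.mp ?_).resolve_right hp
      linear_combination (-(z - (T22.val.map χ).sum / χ 1)) * h1 p
        - (T12.val.map χ).sum / χ 1 * h2 p
    · refine (mul_eq_zero.mp ?_).resolve_right hp
      linear_combination (-(z - (T11.val.map χ).sum / χ 1)) * h2 p
        - (T21.val.map χ).sum / χ 1 * h1 p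
  · rintro ⟨χ, hχ, hz⟩
    obtain ⟨f, hf0, hf⟩ := hχ.exists_centralCharacter
    have hf' : ∀ {T : Finset G}, ConjClosedF T → ∀ h : G,
        ∑ g, (if g * h⁻¹ ∈ T then 1 else 0) * f g = (T.val.map χ).sum / χ 1 * f h := by
      intro T hT h
      rw [← hsum, ← hf _ (hclass hT)]
    obtain ⟨p, q, hpq, h1, h2⟩ : ∃ p q : ℂ, (p ≠ 0 ∨ q ≠ 0) ∧
        (T11.val.map χ).sum / χ 1 * p + (T12.val.map χ).sum / χ 1 * q = z * p ∧
        (T21.val.map χ).sum / χ 1 * p + (T22.val.map χ).sum / χ 1 * q = z * q := by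
      generalize (T11.val.map χ).sum / χ 1 = a at hz ⊢
      generalize (T12.val.map χ).sum / χ 1 = b at hz ⊢
      generalize (T21.val.map χ).sum / χ 1 = c at hz ⊢
      generalize (T22.val.map χ).sum / χ 1 = e at hz ⊢
      by_cases hrow : b = 0 ∧ z - a = 0
      · obtain ⟨rfl, ha⟩ := hrow
        by_cases hc : c = 0
        · exact ⟨1, 0, by simp, by linear_combination -ha, by simp [hc]⟩
        · exact ⟨z - e, c, Or.inr hc, by linear_combination -(z - e) * ha, by ring⟩
      · refine ⟨b, z - a, ?_, by ring, by linear_combination -hz⟩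
        rwa [← not_and_or]
    let w : G ⊕ G → ℂ := Sum.elim (fun g => p * f g) (fun g => q * f g)
    have hsub : ∀ (T : Finset G) (r : ℂ) (h : G),
        ∑ g, (if g * h⁻¹ ∈ T then 1 else 0) * (r * f g) =
          r * ∑ g, (if g * h⁻¹ ∈ T then 1 else 0) * f g := by
      intro T r h
      rw [Finset.mul_sum]
      exact Finset.sum_congr rfl fun g _ => by ring
    have hw : P.mulVec w = z • w := by
      funext x
      rcases x with h | h
      · simp only [hinl, w, Sum.elim_inl, Sum.elim_inr, hsub, hf' h11, hf' h12, Pi.smul_apply,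
          smul_eq_mul]
        linear_combination f h * h1
      · simp only [hinr, w, Sum.elim_inl, Sum.elim_inr, hsub, hf' h21, hf' h22, Pi.smul_apply,
          smul_eq_mul]
        linear_combination f h * h2
    rw [Polynomial.IsRoot, Matrix.eval_charpoly]
    refine Matrix.exists_mulVec_eq_zero_iff.mp ⟨w, fun hw0 => ?_, ?_⟩
    · obtain ⟨g, hg⟩ := Function.ne_iff.mp hf0
      have hl := congrFun hw0 (Sum.inl g)
      have hr := congrFun hw0 (Sum.inr g)
      simp only [w, Sum.elim_inl, Sum.elim_inr, Pi.zero_apply, mul_eq_zero] at hl hr hg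
      rcases hpq with h | h
      · exact hl.elim h hg
      · exact hr.elim h hg
    · rw [Matrix.sub_mulVec, hw]
      simp

theorem Multiset.sum_map_sub_sub_sum_map_sub_s12 {G : Type*} [DecidableEq G] (X Y : Multiset G)
    (χ : G → ℂ) :
    ((X - Y).map χ).sum - ((Y - X).map χ).sum = (X.map χ).sum - (Y.map χ).sum := by
  have h : X - Y + Y = Y - X + X := by
    ext g
    simp only [Multiset.count_add, Multiset.count_sub]
    omega
  have h2 := congrArg (fun Z => (Z.map χ).sum) h
  simp only [Multiset.map_add, Multiset.sum_add] at h2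
  linear_combination h2

theorem IsIrrChar.sq_sub_sum_div_eq_iff {G : Type*} [Group G] [DecidableEq G]
    {T11 T22 T12 T21 : Finset G}
    (h11 : ConjClosedF T11) (h22 : ConjClosedF T22)
    (h12 : ConjClosedF T12) (h21 : ConjClosedF T21)
    {I1 I2 I3 : Multiset G}
    (hI1 : I1 = T11.val + T22.val)
    (hI2 : I2 = msProd T11.val T11.val + msProd T22.val T22.val + 4 • msProd T12.val T21.val)
    (hI3 : I3 = 2 • msProd T11.val T22.val)
    {χ : G → ℂ} (hχ : IsIrrChar G χ) (z : ℂ) :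
    (z - (T11.val.map χ).sum / χ 1) * (z - (T22.val.map χ).sum / χ 1) =
        (T12.val.map χ).sum / χ 1 * ((T21.val.map χ).sum / χ 1) ↔
      (χ 1 * (2 * z) - (I1.map χ).sum) ^ 2 =
        χ 1 * (((I2 - I3).map χ).sum - ((I3 - I2).map χ).sum) := by
  have hd := hχ.apply_one_ne_zero
  rw [Multiset.sum_map_sub_sub_sum_map_sub_s12, hI1, hI2, hI3]
  simp only [Multiset.map_add, Multiset.sum_add, Multiset.map_nsmul, Multiset.sum_nsmul,
    nsmul_eq_mul, Nat.cast_ofNat]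
  have e1 := hχ.sum_msProd _ _ (Finset.val_map_conj h11) (Finset.val_map_conj h11)
  have e2 := hχ.sum_msProd _ _ (Finset.val_map_conj h22) (Finset.val_map_conj h22)
  have e3 := hχ.sum_msProd _ _ (Finset.val_map_conj h12) (Finset.val_map_conj h21)
  have e4 := hχ.sum_msProd _ _ (Finset.val_map_conj h11) (Finset.val_map_conj h22)
  field_simp
  constructor
  · intro h
    linear_combination 4 * h - e1 - e2 - 4 * e3 + 2 * e4
  · intro h
    linear_combination (h + e1 + e2 + 4 * e3 - 2 * e4) / 4

theorem HasEnoughRootsOfUnity.two (L : Type*) [Field L] [CharZero L] :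
    HasEnoughRootsOfUnity L 2 where
  prim := ⟨-1, IsPrimitiveRoot.neg_one 0 (by norm_num)⟩
  cyc := inferInstance

theorem card_monoidHom_units_of_sq_eq_one (H L : Type*) [CommGroup H] [Finite H] [Field L]
    [CharZero L] (hH : ∀ x : H, x ^ 2 = 1) : Nat.card (H →* Lˣ) = Nat.card H := by
  have := HasEnoughRootsOfUnity.two L
  have : HasEnoughRootsOfUnity L (Monoid.exponent H) :=
    .of_dvd L (Monoid.exponent_dvd_of_forall_pow_eq_one hH)
  exact CommGroup.card_monoidHom_of_hasEnoughRootsOfUnity H L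

/-- Kummer theory for extensions generated by square roots. -/
theorem finrank_eq_card_of_adjoin_sqrt {K L : Type*} [Field K] [CharZero K] [Field L]
    [Algebra K L] [FiniteDimensional K L] [IsGalois K L] (S : Set Kˣ)
    (hsq : ∀ a ∈ S, ∃ y : L, y ^ 2 = algebraMap K L a)
    (htop : IntermediateField.adjoin K {y : L | ∃ a ∈ S, y ^ 2 = algebraMap K L a} = ⊤)
    (M : Subgroup (Kˣ ⧸ (powMonoidHom 2 : Kˣ →* Kˣ).range))
    (hM : M = Subgroup.closure (QuotientGroup.mk '' S)) :
    Module.finrank K L = Nat.card M := by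
  have hL : CharZero L := charZero_of_injective_algebraMap (algebraMap K L).injective
  let ι : Kˣ →* Lˣ := Units.map (algebraMap K L)
  let act : Gal(L/K) → Lˣ →* Lˣ := fun σ => Units.map (σ : L →* L)
  have hact_ι : ∀ σ a, act σ (ι a) = ι a := fun σ a => Units.ext (σ.commutes a)
  have hact_mul : ∀ σ τ y, act (σ * τ) y = act σ (act τ y) := fun σ τ y => rfl
  have hsign : ∀ y : Lˣ, y ^ 2 = 1 → ∀ σ, act σ y = y := by
    intro y hy σ
    have : (y : L) = 1 ∨ (y : L) = -1 := by
      have h : (y : L) ^ 2 = 1 := by rw [← Units.val_pow_eq_pow_val, hy, Units.val_one]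
      simpa using h
    ext
    rcases this with h | h <;> simp [act, h]
  have hex : ∀ q ∈ M, ∃ y : Lˣ, y ^ 2 = ι q.out := by
    let N : Subgroup Kˣ := (powMonoidHom 2 : Lˣ →* Lˣ).range.comap ι
    have hle : M ≤ N.map (QuotientGroup.mk' _) := by
      rw [hM, Subgroup.closure_le]
      rintro _ ⟨a, ha, rfl⟩
      obtain ⟨y, hy⟩ := hsq a ha
      have hy0 : y ≠ 0 := by
        rintro rfl
        rw [zero_pow two_ne_zero, eq_comm, map_eq_zero] at hy
        exact a.ne_zero hy
      exact ⟨a, ⟨Units.mk0 y hy0, Units.ext hy⟩, rfl⟩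
    intro q hq
    obtain ⟨a, ⟨y, hy⟩, ha⟩ := hle hq
    rw [← QuotientGroup.out_eq' q, QuotientGroup.mk'_apply, QuotientGroup.eq] at ha
    obtain ⟨c, hc⟩ := ha
    refine ⟨y * ι c, ?_⟩
    rw [powMonoidHom_apply] at hy hc
    rw [mul_pow, hy, ← map_pow, hc, ← map_mul, mul_inv_cancel_left]
  have hex' : ∀ q : M, ∃ y : Lˣ, y ^ 2 = ι q.1.out := fun q => hex q q.2
  choose Y hY using hex'
  have hratio : ∀ σ y a, y ^ 2 = ι a → (act σ y / y) ^ 2 = 1 := by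
    intro σ y a h
    rw [div_pow, ← map_pow, h, hact_ι, div_self']
  have hchar : ∀ (q : M) (y : Lˣ) (a : Kˣ), y ^ 2 = ι a → QuotientGroup.mk a = q.1 →
      ∀ σ, act σ y / y = act σ (Y q) / Y q := by
    intro q y a hy ha σ
    rw [← QuotientGroup.out_eq' q.1, QuotientGroup.eq] at ha
    obtain ⟨c, hc⟩ := ha
    have h1 : (Y q / (ι c * y)) ^ 2 = 1 := by
      rw [powMonoidHom_apply] at hc
      rw [div_pow, mul_pow, hY, hy, ← map_pow, hc, ← map_mul, inv_mul_cancel_comm, div_self']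
    have h2 := hsign _ h1 σ
    rw [map_div, map_mul, hact_ι, div_eq_div_iff_mul_eq_mul] at h2
    rw [div_eq_div_iff_mul_eq_mul]
    apply mul_left_cancel (a := ι c)
    rw [mul_left_comm (ι c) (act σ (Y q)), h2]
    ac_rfl
  let Φ : Gal(L/K) →* M →* Lˣ := MonoidHom.mk' (fun σ => MonoidHom.mk' (fun q => act σ (Y q) / Y q)
    (fun q r => by
      rw [← hchar (q * r) (Y q * Y r) (q.1.out * r.1.out)
        (by rw [mul_pow, hY, hY, map_mul]) (by simp), map_mul, mul_div_mul_comm]))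
    (fun σ τ => by
      ext1 q
      simp only [MonoidHom.mk'_apply, MonoidHom.mul_apply]
      rw [← hsign _ (hratio τ _ _ (hY q)) σ, map_div, hact_mul]
      simp)
  have hΦ : ∀ σ q, Φ σ q = act σ (Y q) / Y q := fun _ _ => rfl
  have hinj : Function.Injective Φ := by
    rw [injective_iff_map_eq_one]
    intro σ hσ
    have hfix : ∀ x ∈ IntermediateField.adjoin K {y : L | ∃ a ∈ S, y ^ 2 = algebraMap K L a},
        σ x = x := by
      refine (IntermediateField.forall_mem_adjoin_smul_eq_self_iff K σ).mpr ?_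
      rintro y ⟨a, ha, hy⟩
      have hy0 : y ≠ 0 := by
        rintro rfl
        rw [zero_pow two_ne_zero, eq_comm, map_eq_zero] at hy
        exact a.ne_zero hy
      have hq : QuotientGroup.mk a ∈ M := hM ▸ Subgroup.subset_closure ⟨a, ha, rfl⟩
      have h := hchar ⟨_, hq⟩ (Units.mk0 y hy0) a (Units.ext hy) rfl σ
      rw [← hΦ, hσ, MonoidHom.one_apply, div_eq_one] at h
      exact congrArg Units.val h
    ext x
    exact hfix x (htop ▸ IntermediateField.mem_top)
  have hinj' : Function.Injective Φ.flip := by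
    rw [injective_iff_map_eq_one]
    intro q hq
    have hfix : ∀ σ : Gal(L/K), σ (Y q : L) = Y q := by
      intro σ
      have h := DFunLike.congr_fun hq σ
      rw [MonoidHom.flip_apply, hΦ, MonoidHom.one_apply, div_eq_one] at h
      exact congrArg Units.val h
    obtain ⟨c, hc⟩ := IntermediateField.mem_bot.mp ((IsGalois.mem_bot_iff_fixed _).mpr hfix)
    have hc0 : c ≠ 0 := by
      rintro rfl
      exact (Y q).ne_zero (by rw [← hc, map_zero])
    have hcY : ι (Units.mk0 c hc0) = Y q := Units.ext hc
    have hιinj : Function.Injective ι := Units.map_injective (algebraMap K L).injective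
    have h := hY q
    rw [← hcY, ← map_pow] at h
    apply Subtype.ext
    rw [← QuotientGroup.out_eq' q.1, OneMemClass.coe_one, QuotientGroup.eq_one_iff]
    exact ⟨_, hιinj h⟩
  have hsqG : ∀ σ : Gal(L/K), σ ^ 2 = 1 := by
    intro σ
    apply hinj
    ext1 q
    rw [map_pow, MonoidHom.pow_apply, hΦ, hratio _ _ _ (hY q), map_one, MonoidHom.one_apply]
  have hsqM : ∀ q : M, q ^ 2 = 1 := by
    intro q
    apply hinj'
    ext1 σ
    rw [map_pow, MonoidHom.pow_apply, MonoidHom.flip_apply, hΦ, hratio _ _ _ (hY q), map_one,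
      MonoidHom.one_apply]
  let _ : CommGroup Gal(L/K) :=
    { (inferInstance : Group Gal(L/K)) with
      mul_comm := fun σ τ => hinj (by rw [map_mul, map_mul]; exact mul_comm (Φ σ) (Φ τ)) }
  have hcG := card_monoidHom_units_of_sq_eq_one Gal(L/K) L hsqG
  have : Finite (Gal(L/K) →* Lˣ) := Nat.finite_of_card_ne_zero (by rw [hcG]; exact Nat.card_pos.ne')
  have : Finite M := Finite.of_injective _ hinj'
  have hcM := card_monoidHom_units_of_sq_eq_one M L hsqM
  have : Finite (M →* Lˣ) := Nat.finite_of_card_ne_zero (by rw [hcM]; exact Nat.card_pos.ne')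
  rw [← IsGalois.card_aut_eq_finrank]
  apply le_antisymm
  · rw [← hcM]; exact Nat.card_le_card_of_injective _ hinj
  · rw [← hcG]; exact Nat.card_le_card_of_injective _ hinj'

/-- The degree of an extension generated inside a Galois extension, through the automorphisms
fixing the generators. -/
theorem IntermediateField.finrank_adjoin_image_mul_card {F N E : Type*} [Field F] [Field N]
    [Field E] [Algebra F N] [Algebra F E] [FiniteDimensional F N] [IsGalois F N] (ι : N →ₐ[F] E)
    (S : Set N) :
    Module.finrank F (IntermediateField.adjoin F (ι '' S)) *
      Nat.card {σ : Gal(N/F) // ∀ x ∈ S, σ x = x} = Module.finrank F N := by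
  have h1 : Nat.card {σ : Gal(N/F) // ∀ x ∈ S, σ x = x} =
      Nat.card (IntermediateField.adjoin F S).fixingSubgroup := by
    refine Nat.card_congr (Equiv.subtypeEquivRight fun σ => ?_)
    rw [IntermediateField.mem_fixingSubgroup_iff]
    exact (IntermediateField.forall_mem_adjoin_smul_eq_self_iff F σ).symm
  rw [h1, IsGalois.card_fixingSubgroup_eq_finrank, ← IntermediateField.adjoin_map,
    ← ((IntermediateField.adjoin F S).equivMap ι).toLinearEquiv.finrank_eq,
    Module.finrank_mul_finrank]

/-- The Galois group of the cyclotomic field acts on character values through power maps. -/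
theorem IsIrrChar.exists_galEquivZMod {G : Type*} [Group G] {m : ℕ} [NeZero m]
    (hm : ∀ g : G, g ^ m = 1) {N : Type*} [Field N] [NumberField N]
    [IsCyclotomicExtension {m} ℚ N] (ι : N →ₐ[ℚ] ℂ) {χ : G → ℂ} (hχ : IsIrrChar G χ) :
    ∃ ψ : G → N, (∀ g, ι (ψ g) = χ g) ∧ ∀ (σ : Gal(N/ℚ)) g,
      σ (ψ g) = ψ (g ^ (IsCyclotomicExtension.Rat.galEquivZMod m N σ).val.val) := by
  obtain ⟨V, _, _, _, _, ρ, -, hρ⟩ := hχ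
  have hroot : ∀ μ : ℂ, μ ^ m = 1 → ∃ ν : N, ν ^ m = 1 ∧ ι ν = μ := by
    intro μ hμ
    have hζ := IsCyclotomicExtension.zeta_spec m ℚ N
    obtain ⟨i, -, rfl⟩ := (hζ.map_of_injective ι.injective).eq_pow_of_pow_eq_one hμ
    exact ⟨_, by rw [pow_right_comm, hζ.pow_eq_one, one_pow], map_pow ι _ i⟩
  have key : ∀ g, ∃ y : N, ι y = χ g ∧ ∀ σ : Gal(N/ℚ),
      ι (σ y) = χ (g ^ (IsCyclotomicExtension.Rat.galEquivZMod m N σ).val.val) := by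
    intro g
    obtain ⟨s, d, hs, hd⟩ := Module.End.exists_trace_pow_eq_sum (ρ g) (NeZero.pos m)
      (by rw [← map_pow, hm, map_one])
    choose! r hr hrι using hroot
    refine ⟨∑ μ ∈ s, d μ * r μ, ?_, fun σ => ?_⟩
    · have h := hd 1
      rw [pow_one, ← hρ] at h
      rw [h, map_sum]
      refine Finset.sum_congr rfl fun μ hμ => ?_
      rw [map_mul, map_natCast, hrι μ (hs μ hμ), pow_one]
    · rw [hρ, map_pow, hd, map_sum, map_sum]
      refine Finset.sum_congr rfl fun μ hμ => ?_
      rw [map_mul, map_natCast, IsCyclotomicExtension.Rat.galEquivZMod_apply_of_pow_eq m N σ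
        (hr μ (hs μ hμ)), map_mul, map_natCast, map_pow, hrι μ (hs μ hμ)]
  choose ψ hψ hσ using key
  exact ⟨ψ, hψ, fun σ g => ι.injective ((hσ g σ).trans (hψ _).symm)⟩

theorem Multiset.sum_map_eq_sum_count {G R : Type*} [Fintype G] [DecidableEq G]
    [NonAssocSemiring R] (X : Multiset G) (χ : G → R) :
    (X.map χ).sum = ∑ g, (X.count g : R) * χ g := by
  induction X using Multiset.induction_on with
  | empty => simp
  | cons a X ih =>
    rw [Multiset.map_cons, Multiset.sum_cons, ih]
    simp [Multiset.count_cons, add_mul, Finset.sum_add_distrib, add_comm]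

theorem Multiset.eq_of_forall_irrChar_sum_eq {G : Type*} [Group G] [Finite G]
    {X Y : Multiset G} (hX : ∀ g, X.map (fun x => g⁻¹ * x * g) = X)
    (hY : ∀ g, Y.map (fun x => g⁻¹ * x * g) = Y)
    (h : ∀ χ, IsIrrChar G χ → (X.map χ).sum = (Y.map χ).sum) : X = Y := by
  classical
  have := Fintype.ofFinite G
  have hinj : ∀ g : G, Function.Injective (fun x => g⁻¹ * x * g) := fun g x y hxy => by
    simpa using hxy
  have hcount : ∀ Z : Multiset G, (∀ g, Z.map (fun x => g⁻¹ * x * g) = Z) →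
      ∀ g x, Z.count (g⁻¹ * x * g) = Z.count x := by
    intro Z hZ g x
    conv_lhs => rw [← hZ g]
    exact Multiset.count_map_eq_count' _ Z (hinj g) x
  have h0 := eq_zero_of_forall_irrChar_sum_eq_zero
    (fun g => (X.count g : ℂ) - (Y.count g : ℂ))
    (fun g x => by rw [hcount X hX, hcount Y hY])
    (fun χ hχ => by
      simp only [sub_mul, Finset.sum_sub_distrib]
      rw [← Multiset.sum_map_eq_sum_count, ← Multiset.sum_map_eq_sum_count, h χ hχ, sub_self])
  ext g
  exact_mod_cast sub_eq_zero.mp (congrFun h0 g)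

theorem Multiset.map_sub_of_injective {α β : Type*} [DecidableEq α] [DecidableEq β] {f : α → β}
    (hf : Function.Injective f) (X Y : Multiset α) : (X - Y).map f = X.map f - Y.map f := by
  ext b
  rw [Multiset.count_sub]
  by_cases hb : ∃ a, f a = b
  · obtain ⟨a, rfl⟩ := hb
    simp only [Multiset.count_map_eq_count' f _ hf, Multiset.count_sub]
  · have h0 : ∀ Z : Multiset α, (Z.map f).count b = 0 := by
      intro Z
      rw [Multiset.count_eq_zero, Multiset.mem_map]
      exact fun ⟨a, _, ha⟩ => hb ⟨a, ha⟩
    simp only [h0, Nat.zero_sub]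

theorem msPow_map_conj {G : Type*} [Group G] {m : ℕ} (t : (ZMod m)ˣ) {X : Multiset G}
    (hX : ∀ g, X.map (fun x => g⁻¹ * x * g) = X) (g : G) :
    (msPow t X).map (fun x => g⁻¹ * x * g) = msPow t X := by
  conv_rhs => rw [← hX g]
  simp only [msPow, Multiset.map_map, Function.comp_def]
  refine Multiset.map_congr rfl fun x _ => ?_
  have h := conj_pow (i := (t : ZMod m).val) (a := g⁻¹) (b := x)
  rw [inv_inv] at h
  exact h.symm

theorem pow_val_unit_injective {G : Type*} [Group G] {m : ℕ} [NeZero m]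
    (hm : ∀ g : G, g ^ m = 1)
    (t : (ZMod m)ˣ) : Function.Injective (fun x : G => x ^ (t : ZMod m).val) := by
  have h : ∀ x : G, (x ^ (t : ZMod m).val) ^ ((t⁻¹ : (ZMod m)ˣ) : ZMod m).val = x := by
    intro x
    have h1 : (t : ZMod m).val * ((t⁻¹ : (ZMod m)ˣ) : ZMod m).val ≡ 1 [MOD m] := by
      rw [← ZMod.natCast_eq_natCast_iff]
      simp
    rw [← pow_mul]
    conv_rhs => rw [← pow_one x]
    exact pow_eq_pow_iff_modEq.mpr (h1.of_dvd (orderOf_dvd_of_pow_eq_one (hm x)))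
  exact Function.LeftInverse.injective h

theorem msPow_sub_eq_iff {G : Type*} [Group G] [Finite G] [DecidableEq G] {m : ℕ} [NeZero m]
    (hm : ∀ g : G, g ^ m = 1) (t : (ZMod m)ˣ) {X Y : Multiset G}
    (hX : ∀ g, X.map (fun x => g⁻¹ * x * g) = X) (hY : ∀ g, Y.map (fun x => g⁻¹ * x * g) = Y) :
    (msPow t (X - Y) = X - Y ∧ msPow t (Y - X) = Y - X) ↔
      ∀ χ, IsIrrChar G χ → ((msPow t (X - Y)).map χ).sum - ((msPow t (Y - X)).map χ).sum =
        ((X - Y).map χ).sum - ((Y - X).map χ).sum := by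
  refine ⟨fun h χ _ => by rw [h.1, h.2], fun h => ?_⟩
  have hconj : ∀ g : G, Function.Injective (fun x => g⁻¹ * x * g) := fun g x y hxy => by
    simpa using hxy
  have hA : ∀ g, (X - Y).map (fun x => g⁻¹ * x * g) = X - Y := fun g => by
    rw [Multiset.map_sub_of_injective (hconj g), hX, hY]
  have hB : ∀ g, (Y - X).map (fun x => g⁻¹ * x * g) = Y - X := fun g => by
    rw [Multiset.map_sub_of_injective (hconj g), hX, hY]
  have hAB : msPow t (X - Y) + (Y - X) = (X - Y) + msPow t (Y - X) := by
    refine Multiset.eq_of_forall_irrChar_sum_eq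
      (fun g => by rw [Multiset.map_add, msPow_map_conj t hA, hB])
      (fun g => by rw [Multiset.map_add, msPow_map_conj t hB, hA]) fun χ hχ => ?_
    simp only [Multiset.map_add, Multiset.sum_add]
    linear_combination h χ hχ
  have hinj := pow_val_unit_injective hm t
  have hcount : ∀ (Z : Multiset G) x, (msPow t Z).count (x ^ (t : ZMod m).val) = Z.count x :=
    fun Z x => Multiset.count_map_eq_count' _ Z hinj x
  have key : ∀ y, (msPow t (X - Y)).count y = (X - Y).count y ∧
      (msPow t (Y - X)).count y = (Y - X).count y := by
    intro y
    have h1 := congrArg (Multiset.count y) hAB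
    obtain ⟨x, rfl⟩ := Finite.surjective_of_injective hinj y
    simp only [Multiset.count_add, hcount, Multiset.count_sub] at h1 ⊢
    omega
  exact ⟨Multiset.ext.mpr fun y => (key y).1, Multiset.ext.mpr fun y => (key y).2⟩

theorem finrank_adjoin_irrChar_sum_mul_card {G : Type*} [Group G] [Finite G] [DecidableEq G]
    {I1 I2 I3 : Multiset G} (hI1 : ∀ g, I1.map (fun x => g⁻¹ * x * g) = I1)
    (hI2 : ∀ g, I2.map (fun x => g⁻¹ * x * g) = I2)
    (hI3 : ∀ g, I3.map (fun x => g⁻¹ * x * g) = I3) :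
    Module.finrank ℚ (IntermediateField.adjoin ℚ
      ({z : ℂ | ∃ χ : G → ℂ, IsIrrChar G χ ∧ z = (I1.map χ).sum}
        ∪ {z : ℂ | ∃ χ : G → ℂ, IsIrrChar G χ ∧
            z = ((I2 - I3).map χ).sum - ((I3 - I2).map χ).sum})) *
      Nat.card {t : (ZMod (Monoid.exponent G))ˣ | msPow t I1 = I1 ∧ msPow t (I2 - I3) = I2 - I3
        ∧ msPow t (I3 - I2) = I3 - I2} = Nat.totient (Monoid.exponent G) := by
  set m := Monoid.exponent G with hmdef
  have : NeZero m := ⟨Monoid.exponent_ne_zero_of_finite⟩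
  have hm : ∀ g : G, g ^ m = 1 := Monoid.pow_exponent_eq_one
  let N := CyclotomicField m ℚ
  have : IsCyclotomicExtension {m} ℚ N := CyclotomicField.isCyclotomicExtension m ℚ
  have : IsGalois ℚ N := IsCyclotomicExtension.isGalois {m} ℚ N
  let ι : N →ₐ[ℚ] ℂ := IsAlgClosed.lift
  choose! ψ hψ hσ using fun (χ : G → ℂ) (hχ : IsIrrChar G χ) => hχ.exists_galEquivZMod hm ι
  have hsum : ∀ χ, IsIrrChar G χ → ∀ X : Multiset G, ι (X.map (ψ χ)).sum = (X.map χ).sum := by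
    intro χ hχ X
    rw [map_multiset_sum, Multiset.map_map]
    exact congrArg Multiset.sum (Multiset.map_congr rfl fun x _ => hψ χ hχ x)
  have hact : ∀ χ, IsIrrChar G χ → ∀ (σ : Gal(N/ℚ)) (X : Multiset G), σ (X.map (ψ χ)).sum =
      ((msPow (IsCyclotomicExtension.Rat.galEquivZMod m N σ) X).map (ψ χ)).sum := by
    intro χ hχ σ X
    rw [map_multiset_sum, msPow, Multiset.map_map, Multiset.map_map]
    exact congrArg Multiset.sum (Multiset.map_congr rfl fun x _ => hσ χ hχ σ x)
  let S : Set N := {z | ∃ χ : G → ℂ, IsIrrChar G χ ∧ z = (I1.map (ψ χ)).sum} ∪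
    {z | ∃ χ : G → ℂ, IsIrrChar G χ ∧
      z = ((I2 - I3).map (ψ χ)).sum - ((I3 - I2).map (ψ χ)).sum}
  have hS : {z : ℂ | ∃ χ : G → ℂ, IsIrrChar G χ ∧ z = (I1.map χ).sum}
        ∪ {z : ℂ | ∃ χ : G → ℂ, IsIrrChar G χ ∧
            z = ((I2 - I3).map χ).sum - ((I3 - I2).map χ).sum} = ι '' S := by
    rw [Set.image_union]
    congr 1 <;> ext z <;> constructor
    · rintro ⟨χ, hχ, rfl⟩
      exact ⟨_, ⟨χ, hχ, rfl⟩, hsum χ hχ _⟩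
    · rintro ⟨_, ⟨χ, hχ, rfl⟩, rfl⟩
      exact ⟨χ, hχ, hsum χ hχ _⟩
    · rintro ⟨χ, hχ, rfl⟩
      exact ⟨_, ⟨χ, hχ, rfl⟩, by rw [map_sub, hsum χ hχ, hsum χ hχ]⟩
    · rintro ⟨_, ⟨χ, hχ, rfl⟩, rfl⟩
      exact ⟨χ, hχ, by rw [map_sub, hsum χ hχ, hsum χ hχ]⟩
  have hcard : Nat.card {t : (ZMod m)ˣ | msPow t I1 = I1 ∧ msPow t (I2 - I3) = I2 - I3
      ∧ msPow t (I3 - I2) = I3 - I2} = Nat.card {σ : Gal(N/ℚ) // ∀ x ∈ S, σ x = x} := by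
    symm
    refine Nat.card_congr ((IsCyclotomicExtension.Rat.galEquivZMod m N).toEquiv.subtypeEquiv
      fun σ => ?_)
    change _ ↔ msPow (IsCyclotomicExtension.Rat.galEquivZMod m N σ) I1 = I1 ∧
      msPow (IsCyclotomicExtension.Rat.galEquivZMod m N σ) (I2 - I3) = I2 - I3 ∧
      msPow (IsCyclotomicExtension.Rat.galEquivZMod m N σ) (I3 - I2) = I3 - I2
    rw [msPow_sub_eq_iff hm _ hI2 hI3]
    constructor
    · intro h
      constructor
      · refine Multiset.eq_of_forall_irrChar_sum_eq (msPow_map_conj _ hI1) hI1 fun χ hχ => ?_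
        rw [← hsum χ hχ, ← hact χ hχ, h _ (Or.inl ⟨χ, hχ, rfl⟩), hsum χ hχ]
      · intro χ hχ
        have h1 := congrArg ι (h _ (Or.inr ⟨χ, hχ, rfl⟩))
        rwa [map_sub, hact χ hχ, hact χ hχ, map_sub, map_sub, hsum χ hχ, hsum χ hχ, hsum χ hχ,
          hsum χ hχ] at h1
    · rintro ⟨h1, h2⟩ x (⟨χ, hχ, rfl⟩ | ⟨χ, hχ, rfl⟩)
      · rw [hact χ hχ, h1]
      · apply ι.injective
        change ι _ = ι _
        rw [map_sub, hact χ hχ, hact χ hχ, map_sub, map_sub, hsum χ hχ, hsum χ hχ, hsum χ hχ,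
          hsum χ hχ, h2 χ hχ]
  rw [hS, hcard, IntermediateField.finrank_adjoin_image_mul_card,
    IsCyclotomicExtension.finrank (n := m) N (Polynomial.cyclotomic.irreducible_rat (NeZero.pos m))]

/-- The degree of a splitting field generated over an intermediate field by square roots. -/
theorem finrank_eq_finrank_mul_card_of_sqrt {K SF : IntermediateField ℚ ℂ} (hle : K ≤ SF)
    {p : Polynomial ℚ} (hp : p ≠ 0)
    (hSF : SF = IntermediateField.adjoin ℚ {z : ℂ | Polynomial.aeval z p = 0}) (S : Set (↥K)ˣ)
    (hS : ∀ a ∈ S, ∀ y : ℂ, y ^ 2 = ((a : K) : ℂ) → y ∈ SF)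
    (hroot : ∀ z : ℂ, Polynomial.aeval z p = 0 → ∃ (u v : K) (y : ℂ), z = u + v * y ∧
      (y = 0 ∨ ∃ a ∈ S, y ^ 2 = ((a : K) : ℂ))) :
    Module.finrank ℚ SF = Module.finrank ℚ K *
      Nat.card (Subgroup.closure ((QuotientGroup.mk : (↥K)ˣ → (↥K)ˣ ⧸
        (powMonoidHom 2 : (↥K)ˣ →* (↥K)ˣ).range) '' S)) := by
  have hset : {z : ℂ | Polynomial.aeval z p = 0} = p.rootSet ℂ := by
    ext z
    rw [Set.mem_ofPred_eq, Polynomial.mem_rootSet]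
    exact ⟨fun h => ⟨hp, h⟩, fun h => h.2⟩
  have hsplit : Polynomial.IsSplittingField ℚ SF p := by
    rw [hSF, hset]
    exact IntermediateField.adjoin_rootSet_isSplittingField (IsAlgClosed.splits _)
  have : FiniteDimensional ℚ SF := Polynomial.IsSplittingField.finiteDimensional SF p
  have : Normal ℚ SF := Normal.of_isSplittingField p
  have : IsGalois ℚ SF := ⟨⟩
  let _ : Algebra K SF := (IntermediateField.inclusion hle).toAlgebra
  have : IsScalarTower ℚ K SF :=
    IsScalarTower.of_algebraMap_eq fun x => ((IntermediateField.inclusion hle).commutes x).symm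
  have : IsGalois K SF := IsGalois.tower_top_of_isGalois ℚ K SF
  have : FiniteDimensional K SF := FiniteDimensional.right ℚ K SF
  have hmap : ∀ x : K, ((algebraMap K SF x : SF) : ℂ) = x := fun x => rfl
  rw [← Module.finrank_mul_finrank ℚ K SF]
  congr 1
  refine finrank_eq_card_of_adjoin_sqrt S ?_ ?_ _ rfl
  · intro a ha
    obtain ⟨y, hy⟩ := IsAlgClosed.exists_pow_nat_eq ((a : K) : ℂ) (n := 2) two_pos
    exact ⟨⟨y, hS a ha y hy⟩, Subtype.ext hy⟩
  · set E := IntermediateField.adjoin K {y : SF | ∃ a ∈ S, y ^ 2 = algebraMap K SF a}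
    have key : ∀ x ∈ IntermediateField.adjoin ℚ {z : ℂ | Polynomial.aeval z p = 0},
        ∃ h : x ∈ SF, (⟨x, h⟩ : SF) ∈ E := by
      intro x hx
      induction hx using IntermediateField.adjoin_induction with
      | mem z hz =>
        obtain ⟨u, v, y, rfl, hy⟩ := hroot z hz
        have hyE : ∃ h : y ∈ SF, (⟨y, h⟩ : SF) ∈ E := by
          rcases hy with rfl | ⟨a, ha, hy⟩
          · exact ⟨SF.zero_mem, E.zero_mem⟩
          · exact ⟨hS a ha y hy, IntermediateField.subset_adjoin K _ ⟨a, ha, Subtype.ext hy⟩⟩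
        obtain ⟨hySF, hyE⟩ := hyE
        exact ⟨SF.add_mem (hle u.2) (SF.mul_mem (hle v.2) hySF),
          E.add_mem (E.algebraMap_mem u) (E.mul_mem (E.algebraMap_mem v) hyE)⟩
      | algebraMap x =>
        refine ⟨SF.algebraMap_mem x, ?_⟩
        have h := E.algebraMap_mem (algebraMap ℚ K x)
        exact h
      | add x y _ _ hx hy => exact ⟨SF.add_mem hx.1 hy.1, E.add_mem hx.2 hy.2⟩
      | inv x _ hx => exact ⟨SF.inv_mem hx.1, E.inv_mem hx.2⟩
      | mul x y _ _ hx hy => exact ⟨SF.mul_mem hx.1 hy.1, E.mul_mem hx.2 hy.2⟩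
    rw [eq_top_iff]
    rintro ⟨x, hx⟩ -
    exact (key x (hSF ▸ hx)).2

theorem stmt_12 {G : Type*} [Group G] [Fintype G] [DecidableEq G]
    (T11 T22 T12 T21 : Finset G)
    (h11 : ConjClosedF T11) (h22 : ConjClosedF T22)
    (h12 : ConjClosedF T12) (h21 : ConjClosedF T21)
    (I1 I2 I3 : Multiset G)
    (hI1 : I1 = T11.val + T22.val)
    (hI2 : I2 = msProd T11.val T11.val + msProd T22.val T22.val + 4 • msProd T12.val T21.val)
    (hI3 : I3 = 2 • msProd T11.val T22.val)
    (SF : IntermediateField ℚ ℂ)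
    (hSF : SF = IntermediateField.adjoin ℚ
      {z : ℂ | Polynomial.aeval z (scMatrix T11 T22 T12 T21).charpoly = 0})
    (T : Set (ZMod (Monoid.exponent G))ˣ)
    (hT : T = {t | msPow t I1 = I1 ∧ msPow t (I2 - I3) = I2 - I3
        ∧ msPow t (I3 - I2) = I3 - I2})
    (K : IntermediateField ℚ ℂ)
    (hK : K = IntermediateField.adjoin ℚ
      ({z : ℂ | ∃ χ : G → ℂ, IsIrrChar G χ ∧ z = (I1.map χ).sum}
        ∪ {z : ℂ | ∃ χ : G → ℂ, IsIrrChar G χ ∧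
            z = ((I2 - I3).map χ).sum - ((I3 - I2).map χ).sum}))
    (hvals : ∀ χ : G → ℂ, IsIrrChar G χ →
      χ 1 * (((I2 - I3).map χ).sum - ((I3 - I2).map χ).sum) ∈ K)
    (M : Subgroup ((↥K)ˣ ⧸ (powMonoidHom 2 : (↥K)ˣ →* (↥K)ˣ).range))
    (hM : M = Subgroup.closure
      {q | ∃ (χ : G → ℂ) (hχ : IsIrrChar G χ)
          (hne : (⟨χ 1 * (((I2 - I3).map χ).sum - ((I3 - I2).map χ).sum),
                    hvals χ hχ⟩ : ↥K) ≠ 0),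
        q = QuotientGroup.mk (Units.mk0 _ hne)}) :
    Module.finrank ℚ ↥SF * Nat.card T
      = Nat.totient (Monoid.exponent G) * Nat.card ↥M := by
  subst hT
  have conj_add : ∀ {X Y : Multiset G}, (∀ g, X.map (fun x => g⁻¹ * x * g) = X) →
      (∀ g, Y.map (fun x => g⁻¹ * x * g) = Y) →
      ∀ g, (X + Y).map (fun x => g⁻¹ * x * g) = X + Y := fun hX hY g => by
    rw [Multiset.map_add, hX, hY]
  have conj_smul : ∀ (n : ℕ) {X : Multiset G}, (∀ g, X.map (fun x => g⁻¹ * x * g) = X) →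
      ∀ g, (n • X).map (fun x => g⁻¹ * x * g) = n • X := fun n X hX g => by
    rw [Multiset.map_nsmul, hX]
  have v11 := Finset.val_map_conj h11
  have v22 := Finset.val_map_conj h22
  have v12 := Finset.val_map_conj h12
  have v21 := Finset.val_map_conj h21
  have hKT := finrank_adjoin_irrChar_sum_mul_card (hI1 ▸ conj_add v11 v22)
    (hI2 ▸ conj_add (conj_add (msProd_map_conj v11 v11) (msProd_map_conj v22 v22))
      (conj_smul 4 (msProd_map_conj v12 v21)))
    (hI3 ▸ conj_smul 2 (msProd_map_conj v11 v22))
  rw [← hK] at hKT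
  have hiff : ∀ z : ℂ, Polynomial.aeval z (scMatrix T11 T22 T12 T21).charpoly = 0 ↔
      ∃ χ, IsIrrChar G χ ∧ (χ 1 * (2 * z) - (I1.map χ).sum) ^ 2 =
        χ 1 * (((I2 - I3).map χ).sum - ((I3 - I2).map χ).sum) := by
    intro z
    rw [aeval_charpoly_scMatrix_eq_zero_iff h11 h22 h12 h21]
    exact exists_congr fun χ => and_congr_right fun hχ =>
      hχ.sq_sub_sum_div_eq_iff h11 h22 h12 h21 hI1 hI2 hI3 z
  have hmem : ∀ χ, IsIrrChar G χ → ∀ y : ℂ,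
      y ^ 2 = χ 1 * (((I2 - I3).map χ).sum - ((I3 - I2).map χ).sum) →
      y ∈ SF ∧ (I1.map χ).sum ∈ SF := by
    intro χ hχ y hy
    have h0 := hχ.apply_one_ne_zero
    obtain ⟨d, -, hd⟩ := hχ.exists_natCast
    have hz : ∀ w : ℂ, w ^ 2 = χ 1 * (((I2 - I3).map χ).sum - ((I3 - I2).map χ).sum) →
        ((I1.map χ).sum + w) / (2 * χ 1) ∈ SF := by
      intro w hw
      rw [hSF]
      refine IntermediateField.subset_adjoin ℚ _ ((hiff _).mpr ⟨χ, hχ, ?_⟩)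
      rw [← hw]
      field_simp
      ring
    have h1 := hz y hy
    have h2 := hz (-y) (by rw [neg_sq, hy])
    have hdSF : χ 1 ∈ SF := hd ▸ IntermediateField.natCast_mem SF d
    constructor
    · convert SF.mul_mem hdSF (SF.sub_mem h1 h2) using 1
      field_simp
      ring
    · convert SF.mul_mem hdSF (SF.add_mem h1 h2) using 1
      field_simp
      ring
  have hle : K ≤ SF := by
    rw [hK, IntermediateField.adjoin_le_iff]
    rintro _ (⟨χ, hχ, rfl⟩ | ⟨χ, hχ, rfl⟩) <;>
      obtain ⟨y, hy⟩ := IsAlgClosed.exists_pow_nat_eq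
        (χ 1 * (((I2 - I3).map χ).sum - ((I3 - I2).map χ).sum)) (n := 2) two_pos
    · exact (hmem χ hχ y hy).2
    · obtain ⟨d, -, hd⟩ := hχ.exists_natCast
      rw [← mul_div_cancel_left₀ (((I2 - I3).map χ).sum - ((I3 - I2).map χ).sum)
        hχ.apply_one_ne_zero, ← hy, hd]
      exact SF.div_mem (SF.pow_mem (hmem χ hχ y hy).1 2) (IntermediateField.natCast_mem SF d)
  have hMS := finrank_eq_finrank_mul_card_of_sqrt hle
    (Matrix.charpoly_monic (scMatrix T11 T22 T12 T21)).ne_zero hSF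
    {a | ∃ χ, IsIrrChar G χ ∧
      ((a : K) : ℂ) = χ 1 * (((I2 - I3).map χ).sum - ((I3 - I2).map χ).sum)}
    (by
      rintro a ⟨χ, hχ, ha⟩ y hy
      exact (hmem χ hχ y (hy.trans ha)).1)
    (by
      intro z hz
      obtain ⟨χ, hχ, h⟩ := (hiff z).mp hz
      have h0 := hχ.apply_one_ne_zero
      obtain ⟨d, -, hd⟩ := hχ.exists_natCast
      have hs : (I1.map χ).sum ∈ K :=
        hK ▸ IntermediateField.subset_adjoin ℚ _ (Or.inl ⟨χ, hχ, rfl⟩)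
      refine ⟨⟨_, hs⟩ / (2 * d), 1 / (2 * d), χ 1 * (2 * z) - (I1.map χ).sum, ?_, ?_⟩
      · push_cast
        rw [← hd, show ((2 : K) : ℂ) = 2 from rfl]
        field_simp
        ring
      · rw [or_iff_not_imp_left]
        intro hy
        have hne : χ 1 * (((I2 - I3).map χ).sum - ((I3 - I2).map χ).sum) ≠ 0 :=
          h ▸ pow_ne_zero 2 hy
        exact ⟨Units.mk0 ⟨_, hvals χ hχ⟩ (fun h => hne (congrArg Subtype.val h)),
          ⟨χ, hχ, rfl⟩, h⟩)
  have hgen : {q | ∃ (χ : G → ℂ) (hχ : IsIrrChar G χ)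
          (hne : (⟨χ 1 * (((I2 - I3).map χ).sum - ((I3 - I2).map χ).sum),
                    hvals χ hχ⟩ : ↥K) ≠ 0),
        q = QuotientGroup.mk (Units.mk0 _ hne)} =
      (QuotientGroup.mk : (↥K)ˣ → (↥K)ˣ ⧸ (powMonoidHom 2 : (↥K)ˣ →* (↥K)ˣ).range) ''
        {a | ∃ χ, IsIrrChar G χ ∧
          ((a : K) : ℂ) = χ 1 * (((I2 - I3).map χ).sum - ((I3 - I2).map χ).sum)} := by
    ext q
    constructor
    · rintro ⟨χ, hχ, hne, rfl⟩
      exact ⟨_, ⟨χ, hχ, rfl⟩, rfl⟩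
    · rintro ⟨a, ⟨χ, hχ, ha⟩, rfl⟩
      have ha' : (⟨_, hvals χ hχ⟩ : K) = a := Subtype.ext ha.symm
      exact ⟨χ, hχ, ha' ▸ a.ne_zero, congrArg _ (Units.ext ha'.symm)⟩
  rw [hM, hgen, hMS, mul_right_comm, hKT]
end
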